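/- arXiv:1207.5123 — 4 statements merged into one kernel-verified Lean document; each statement's English description precedes it below -/
import Mathlib

section
/- Let M = {A_i}_{i∈I} be a finite nonempty set of real n×n matrices. The switching system x_{t+1} = A_{σ(t)} x_t converges to the origin for every initial point x₀ ∈ ℝ^n and every switching signal σ : ℕ → I (that is, for every σ and x₀ the sequence x_t = A_{σ(t−1)}⋯A_{σ(0)} x₀ tends to 0) if and only if ρ̂(M) < 1. -/
open Matrix Filter

attribute [local instance] Matrix.frobeniusNormedAddCommGroup

/-- Products of length `k` of matrices from `M`. -/
def prodsLen {n : ℕ} (M : Set (Matrix (Fin n) (Fin n) ℝ)) (k : ℕ) :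
    Set (Matrix (Fin n) (Fin n) ℝ) :=
  {P | ∃ l : List (Matrix (Fin n) (Fin n) ℝ),
      l.length = k ∧ (∀ A ∈ l, A ∈ M) ∧ P = l.prod}

/-- Joint spectral radius of a set of matrices (the `limsup` of
`max_{P ∈ P_k(M)} ‖P‖^(1/k)`; for finite nonempty `M` the limit exists,
so this coincides with the usual definition). -/
noncomputable def jsr {n : ℕ} (M : Set (Matrix (Fin n) (Fin n) ℝ)) : ℝ :=
  limsup (fun k : ℕ => sSup ((fun P => ‖P‖ ^ ((1:ℝ)/k)) '' prodsLen M k)) atTop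

/-- The product `A (σ (t - 1)) * ⋯ * A (σ 0)`. -/
def switchProd {n : ℕ} {ι : Type*} (A : ι → Matrix (Fin n) (Fin n) ℝ) (σ : ℕ → ι) (t : ℕ) :
    Matrix (Fin n) (Fin n) ℝ :=
  ((List.range t).reverse.map (fun s => A (σ s))).prod

section SwitchProd

variable {n : ℕ} {ι : Type*} (A : ι → Matrix (Fin n) (Fin n) ℝ)

lemma switchProd_zero (σ : ℕ → ι) : switchProd A σ 0 = 1 := by
  simp [switchProd]

lemma switchProd_succ (σ : ℕ → ι) (t : ℕ) :
    switchProd A σ (t + 1) = A (σ t) * switchProd A σ t := by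
  simp [switchProd, List.range_succ]

lemma switchProd_add (σ : ℕ → ι) (t s : ℕ) :
    switchProd A σ (t + s) = switchProd A (fun i => σ (t + i)) s * switchProd A σ t := by
  induction s with
  | zero => simp [switchProd_zero]
  | succ s ih => rw [← add_assoc, switchProd_succ, ih, switchProd_succ, mul_assoc]

lemma switchProd_congr {σ τ : ℕ → ι} {t : ℕ} (h : ∀ s < t, σ s = τ s) :
    switchProd A σ t = switchProd A τ t := by
  induction t with
  | zero => simp [switchProd_zero]
  | succ t ih =>
    rw [switchProd_succ, switchProd_succ, ih fun s hs => h s (by omega), h t (by omega)]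

lemma switchProd_mem_prodsLen (σ : ℕ → ι) (t : ℕ) :
    switchProd A σ t ∈ prodsLen (Set.range A) t := by
  refine ⟨(List.range t).reverse.map (fun s => A (σ s)), by simp, ?_, rfl⟩
  intro B hB
  obtain ⟨s, -, rfl⟩ := List.mem_map.1 hB
  exact ⟨_, rfl⟩

lemma exists_switchProd_eq_prod [Nonempty ι] (l : List (Matrix (Fin n) (Fin n) ℝ))
    (hl : ∀ B ∈ l, B ∈ Set.range A) : ∃ σ : ℕ → ι, l.prod = switchProd A σ l.length := by
  induction l with
  | nil => exact ⟨fun _ => Classical.arbitrary ι, by simp [switchProd_zero]⟩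
  | cons B l ih =>
    obtain ⟨σ, hσ⟩ := ih fun C hC => hl C (List.mem_cons_of_mem _ hC)
    obtain ⟨i, rfl⟩ := hl B List.mem_cons_self
    refine ⟨Function.update σ l.length i, ?_⟩
    rw [List.prod_cons, List.length_cons, switchProd_succ, Function.update_self, hσ]
    congr 1
    exact switchProd_congr A fun s hs => (Function.update_of_ne hs.ne i σ).symm

lemma prodsLen_range [Nonempty ι] (k : ℕ) :
    prodsLen (Set.range A) k = Set.range fun σ : ℕ → ι => switchProd A σ k := by
  ext P
  constructor
  · rintro ⟨l, rfl, hl, rfl⟩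
    obtain ⟨σ, hσ⟩ := exists_switchProd_eq_prod A l hl
    exact ⟨σ, hσ.symm⟩
  · rintro ⟨σ, rfl⟩
    exact switchProd_mem_prodsLen A σ k

lemma exists_norm_switchProd_le [Fintype ι] :
    ∃ C : ℝ, 1 ≤ C ∧ ∀ σ : ℕ → ι, ∀ k,
      ‖switchProd A σ k‖ ≤ C ^ k * ‖(1 : Matrix (Fin n) (Fin n) ℝ)‖ := by
  refine ⟨1 + ∑ i, ‖A i‖, ?_, fun σ k => ?_⟩
  · have : 0 ≤ ∑ i, ‖A i‖ := Finset.sum_nonneg fun i _ => norm_nonneg _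
    linarith
  · induction k with
    | zero => simp [switchProd_zero]
    | succ k ih =>
      have h : ‖A (σ k)‖ ≤ 1 + ∑ i, ‖A i‖ := by
        have := Finset.single_le_sum (f := fun i => ‖A i‖) (fun i _ => norm_nonneg _)
          (Finset.mem_univ (σ k))
        linarith
      rw [switchProd_succ, pow_succ', mul_assoc]
      refine (Matrix.frobenius_norm_mul _ _).trans ?_
      exact mul_le_mul h ih (norm_nonneg _) ((norm_nonneg _).trans h)

lemma continuous_switchProd [TopologicalSpace ι] [DiscreteTopology ι] (t : ℕ) :
    Continuous fun σ : ℕ → ι => switchProd A σ t := by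
  induction t with
  | zero => simpa only [switchProd_zero] using continuous_const
  | succ t ih =>
    simp only [switchProd_succ]
    exact (continuous_of_discreteTopology.comp (continuous_apply t)).matrix_mul ih

/-- If every infinite product tends to zero, then products shrink by a factor `1 / 2` within a
uniformly bounded number of steps. -/
lemma exists_uniform_contraction_time [Finite ι]
    (h : ∀ σ : ℕ → ι, Tendsto (switchProd A σ) atTop (nhds 0)) :
    ∃ T : ℕ, 1 ≤ T ∧ ∀ σ : ℕ → ι, ∃ t, 1 ≤ t ∧ t ≤ T ∧ ‖switchProd A σ t‖ < 1 / 2 := by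
  let _ : TopologicalSpace ι := ⊥
  have : DiscreteTopology ι := ⟨rfl⟩
  let U : ℕ → Set (ℕ → ι) := fun t => {σ | 1 ≤ t ∧ ‖switchProd A σ t‖ < 1 / 2}
  have hU : ∀ t, IsOpen (U t) := fun t =>
    isOpen_const.and (isOpen_lt (continuous_switchProd A t).norm continuous_const)
  have hcov : (Set.univ : Set (ℕ → ι)) ⊆ ⋃ t, U t := by
    intro σ _
    have h1 : ∀ᶠ t in atTop, ‖switchProd A σ t‖ < 1 / 2 := by
      have h2 := (h σ).norm
      rw [norm_zero] at h2
      exact h2.eventually_lt_const (by norm_num)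
    obtain ⟨t, ht, ht'⟩ := ((eventually_ge_atTop 1).and h1).exists
    exact Set.mem_iUnion.2 ⟨t, ht, ht'⟩
  obtain ⟨s, hs⟩ := isCompact_univ.elim_finite_subcover U hU hcov
  refine ⟨s.sup id + 1, by omega, fun σ => ?_⟩
  obtain ⟨t, hts, ht1, ht2⟩ := Set.mem_iUnion₂.1 (hs (Set.mem_univ σ))
  have : t ≤ s.sup id := Finset.le_sup (f := id) hts
  exact ⟨t, ht1, by omega, ht2⟩

lemma exists_norm_switchProd_le_geometric [Fintype ι]
    (h : ∀ σ : ℕ → ι, Tendsto (switchProd A σ) atTop (nhds 0)) :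
    ∃ C q : ℝ, 0 < C ∧ 0 < q ∧ q < 1 ∧ ∀ k, ∀ σ : ℕ → ι, ‖switchProd A σ k‖ ≤ C * q ^ k := by
  obtain ⟨T, hT, hT'⟩ := exists_uniform_contraction_time A h
  obtain ⟨B, hB, hB'⟩ := exists_norm_switchProd_le A
  set N := ‖(1 : Matrix (Fin n) (Fin n) ℝ)‖ with hN
  have hN0 : 0 ≤ N := norm_nonneg _
  have hT0 : (T : ℝ) ≠ 0 := by positivity
  set q : ℝ := (1 / 2 : ℝ) ^ ((1 : ℝ) / T) with hq
  have hq0 : 0 < q := by positivity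
  have hq1 : q < 1 := Real.rpow_lt_one (by norm_num) (by norm_num) (by positivity)
  have hqT : q ^ T = 1 / 2 := by
    rw [hq, ← Real.rpow_natCast, ← Real.rpow_mul (by norm_num), one_div_mul_cancel hT0,
      Real.rpow_one]
  have hB0 : 0 < B ^ T := by positivity
  refine ⟨2 * (B ^ T * (N + 1)), q, by positivity, hq0, hq1, fun k => ?_⟩
  induction k using Nat.strong_induction_on with
  | _ k ih =>
    intro σ
    have hC : 0 ≤ 2 * (B ^ T * (N + 1)) := by positivity
    rcases le_or_gt k T with hk | hk
    · have hqk : 1 / 2 ≤ q ^ k := hqT ▸ pow_le_pow_of_le_one hq0.le hq1.le hk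
      calc ‖switchProd A σ k‖ ≤ B ^ k * N := hB' σ k
        _ ≤ B ^ T * (N + 1) := by
          gcongr
          linarith
        _ = 2 * (B ^ T * (N + 1)) * (1 / 2) := by ring
        _ ≤ _ := by gcongr
    · obtain ⟨t, ht1, htT, ht⟩ := hT' σ
      have hqt : 1 / 2 ≤ q ^ t := hqT ▸ pow_le_pow_of_le_one hq0.le hq1.le htT
      obtain ⟨s, rfl⟩ : ∃ s, k = t + s := ⟨k - t, by omega⟩
      rw [switchProd_add]
      refine (Matrix.frobenius_norm_mul _ _).trans ?_
      calc _ ≤ (2 * (B ^ T * (N + 1)) * q ^ s) * q ^ t := by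
            refine mul_le_mul (ih s (by omega) _) (ht.le.trans hqt) (norm_nonneg _) (by positivity)
        _ = _ := by ring

end SwitchProd

section JointSpectralRadius

variable {n : ℕ} {ι : Type*} [Nonempty ι] (A : ι → Matrix (Fin n) (Fin n) ℝ)

lemma sSup_prodsLen_nonneg (M : Set (Matrix (Fin n) (Fin n) ℝ)) (k : ℕ) :
    0 ≤ sSup ((fun P => ‖P‖ ^ ((1 : ℝ) / k)) '' prodsLen M k) := by
  apply Real.sSup_nonneg
  rintro _ ⟨P, -, rfl⟩
  positivity

lemma mem_upperBounds_prodsLen_of_norm_le {C q : ℝ} (hC : 0 ≤ C) (hq : 0 ≤ q) {k : ℕ} (hk : k ≠ 0)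
    (h : ∀ σ : ℕ → ι, ‖switchProd A σ k‖ ≤ C * q ^ k) :
    C ^ ((1 : ℝ) / k) * q ∈
      upperBounds ((fun P => ‖P‖ ^ ((1 : ℝ) / k)) '' prodsLen (Set.range A) k) := by
  rw [prodsLen_range]
  rintro _ ⟨_, ⟨σ, rfl⟩, rfl⟩
  calc ‖switchProd A σ k‖ ^ ((1 : ℝ) / k) ≤ (C * q ^ k) ^ ((1 : ℝ) / k) :=
        Real.rpow_le_rpow (norm_nonneg _) (h σ) (by positivity)
    _ = C ^ ((1 : ℝ) / k) * q := by
        rw [Real.mul_rpow hC (by positivity), one_div, Real.pow_rpow_inv_natCast hq hk]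

lemma tendsto_const_rpow_one_div {C : ℝ} (hC : 0 < C) (q : ℝ) :
    Tendsto (fun k : ℕ => C ^ ((1 : ℝ) / k) * q) atTop (nhds q) := by
  have h := (tendsto_const_nhds (x := C)).rpow tendsto_one_div_atTop_nhds_zero_nat (Or.inl hC.ne')
  simpa using h.mul_const q

lemma jsr_range_lt_one_of_geometric {C q : ℝ} (hC : 0 < C) (hq : 0 < q) (hq1 : q < 1)
    (h : ∀ k, ∀ σ : ℕ → ι, ‖switchProd A σ k‖ ≤ C * q ^ k) : jsr (Set.range A) < 1 := by
  obtain ⟨r, hqr, hr⟩ := exists_between hq1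
  refine lt_of_le_of_lt ?_ hr
  refine limsup_le_of_le
    (isCoboundedUnder_le_of_le atTop fun k => sSup_prodsLen_nonneg (Set.range A) k) ?_
  filter_upwards [(tendsto_const_rpow_one_div hC q).eventually_lt_const hqr,
    eventually_ne_atTop 0] with k hk hk0
  refine Real.sSup_le (fun x hx => ?_) (hq.le.trans hqr.le)
  exact (mem_upperBounds_prodsLen_of_norm_le A hC.le hq.le hk0 (h k) hx).trans hk.le

lemma tendsto_switchProd_of_jsr_lt_one [Fintype ι] (h : jsr (Set.range A) < 1) (σ : ℕ → ι) :
    Tendsto (switchProd A σ) atTop (nhds 0) := by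
  obtain ⟨r', hr', hr1⟩ := exists_between h
  set r := max r' 0 with hr
  have hr0 : 0 ≤ r := le_max_right _ _
  have hrlt : r < 1 := max_lt hr1 one_pos
  obtain ⟨B, hB, hB'⟩ := exists_norm_switchProd_le A
  set N := ‖(1 : Matrix (Fin n) (Fin n) ℝ)‖ with hN
  have hN0 : 0 ≤ N := norm_nonneg _
  have hub (k : ℕ) (hk : k ≠ 0) := mem_upperBounds_prodsLen_of_norm_le A (C := N + 1) (q := B)
    (by positivity) (by positivity) hk fun τ => (hB' τ k).trans <| by
      rw [mul_comm]; gcongr; linarith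
  have hbdd : IsBoundedUnder (· ≤ ·) atTop fun k : ℕ =>
      sSup ((fun P => ‖P‖ ^ ((1 : ℝ) / k)) '' prodsLen (Set.range A) k) := by
    refine ⟨B + 1, eventually_map.2 ?_⟩
    filter_upwards [(tendsto_const_rpow_one_div (C := N + 1) (by positivity) B).eventually_lt_const
      (lt_add_one B), eventually_ne_atTop 0] with k hk hk0
    exact Real.sSup_le (fun x hx => (hub k hk0 hx).trans hk.le) (by positivity)
  have hev := eventually_lt_of_limsup_lt hr' hbdd
  refine squeeze_zero_norm' ?_ (tendsto_pow_atTop_nhds_zero_of_lt_one hr0 hrlt)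
  filter_upwards [hev, eventually_ne_atTop 0] with k hk hk0
  have h1 : ‖switchProd A σ k‖ ^ ((1 : ℝ) / k) ≤ r :=
    (le_csSup ⟨_, hub k hk0⟩ ⟨_, switchProd_mem_prodsLen A σ k, rfl⟩).trans
      (hk.le.trans (le_max_left _ _))
  calc ‖switchProd A σ k‖ = (‖switchProd A σ k‖ ^ ((1 : ℝ) / k)) ^ k := by
        rw [one_div, Real.rpow_inv_natCast_pow (norm_nonneg _) hk0]
    _ ≤ r ^ k := by gcongr

end JointSpectralRadius

/-- A sequence of matrices tends to zero iff it does so when applied to each vector. -/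
lemma Matrix.tendsto_zero_iff_forall_mulVec {n : ℕ} {P : ℕ → Matrix (Fin n) (Fin n) ℝ} :
    Tendsto P atTop (nhds 0) ↔
      ∀ x : Fin n → ℝ, Tendsto (fun t => (P t).mulVec x) atTop (nhds 0) := by
  constructor
  · intro h x
    have hc : Continuous fun Q : Matrix (Fin n) (Fin n) ℝ => Q.mulVec x :=
      continuous_id.matrix_mulVec continuous_const
    simpa [Function.comp_def] using (hc.tendsto 0).comp h
  · intro h
    refine tendsto_pi_nhds.2 fun i => tendsto_pi_nhds.2 fun j => ?_
    simpa using tendsto_pi_nhds.1 (h (Pi.single j 1)) i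

/-- the switching system `x_{t+1} = A_{σ(t)} x_t` converges to the
origin for every initial point and every switching signal iff `ρ̂(M) < 1`. -/
theorem stmt7 {n : ℕ} {ι : Type*} [Fintype ι] [Nonempty ι]
    (A : ι → Matrix (Fin n) (Fin n) ℝ) :
    (∀ σ : ℕ → ι, ∀ x₀ : Fin n → ℝ,
      Tendsto
        (fun t : ℕ =>
          (((List.range t).reverse.map (fun s => A (σ s))).prod).mulVec x₀)
        atTop (nhds 0))
    ↔ jsr (Set.range A) < 1 := by
  constructor
  · intro h
    obtain ⟨C, q, hC, hq, hq1, hle⟩ := exists_norm_switchProd_le_geometric A fun σ =>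
      Matrix.tendsto_zero_iff_forall_mulVec.2 (h σ)
    exact jsr_range_lt_one_of_geometric A hC hq hq1 hle
  · intro h σ
    exact Matrix.tendsto_zero_iff_forall_mulVec.1 (tendsto_switchProd_of_jsr_lt_one A h σ)
end

section
/- For a finite nonempty set M of real n×n matrices, the generalized spectral radius equals the joint spectral radius: limsup_{k→∞} max_{P∈P_k(M)} ρ(P)^{1/k} = ρ̂(M), where ρ(P) denotes the spectral radius of the matrix P. -/
open Matrix Filter

attribute [local instance] Matrix.frobeniusNormedAddCommGroup

/-- The spectral radius of a real matrix: the maximum modulus of its complex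
eigenvalues. -/
noncomputable def specRad {n : ℕ} (P : Matrix (Fin n) (Fin n) ℝ) : ℝ :=
  (spectralRadius ℂ (P.map (algebraMap ℝ ℂ))).toReal

theorem Matrix.isNilpotent_of_trace_pow_eq_zero {n : ℕ} (A : Matrix (Fin n) (Fin n) ℝ)
    (h : ∀ k : ℕ, (A ^ (k + 1)).trace = 0) : IsNilpotent A := by
  obtain ⟨g, hg, hX⟩ := Polynomial.exists_eq_pow_rootMultiplicity_mul_and_not_dvd A.charpoly
    A.charpoly_monic.ne_zero 0
  rw [Polynomial.C_0, sub_zero] at hg hX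
  set m := Polynomial.rootMultiplicity 0 A.charpoly
  have hcop : IsCoprime ((Polynomial.X : Polynomial ℝ) ^ (m + 1)) g :=
    ((Polynomial.irreducible_X.coprime_iff_not_dvd).2 hX).pow_left
  obtain ⟨u, v, huv⟩ := hcop
  have hAg : A ^ m * Polynomial.aeval A g = 0 := by
    have := A.aeval_self_charpoly
    rwa [hg, map_mul, map_pow, Polynomial.aeval_X] at this
  have h1 : Polynomial.aeval A u * A ^ (m + 1)
      + Polynomial.aeval A v * Polynomial.aeval A g = 1 := by
    have := congrArg (Polynomial.aeval A) huv
    simpa using this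
  have hcomm : ∀ p q : Polynomial ℝ, Polynomial.aeval A p * Polynomial.aeval A q
      = Polynomial.aeval A q * Polynomial.aeval A p := fun p q => by
    rw [← map_mul, ← map_mul, mul_comm]
  set e := Polynomial.aeval A u * A ^ (m + 1) with he
  have hzero : e * (Polynomial.aeval A v * Polynomial.aeval A g) = 0 := by
    rw [hcomm v g, he, pow_succ', mul_assoc, mul_assoc, ← mul_assoc (A ^ m), hAg]
    simp
  have hidem : IsIdempotentElem e := by
    have : e * (e + Polynomial.aeval A v * Polynomial.aeval A g) = e * 1 := by rw [h1]
    rwa [mul_add, hzero, add_zero, mul_one] at this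
  have htr : e.trace = 0 := by
    rw [he, Polynomial.aeval_eq_sum_range, Finset.sum_mul, Matrix.trace_sum]
    refine Finset.sum_eq_zero fun i _ => ?_
    rw [smul_mul_assoc, ← pow_add, Matrix.trace_smul, ← add_assoc, h, smul_zero]
  have he0 : e = 0 := by
    have hid : IsIdempotentElem (Matrix.toLin' e) := by
      rw [IsIdempotentElem, Module.End.mul_eq_comp, ← Matrix.toLin'_mul, hidem]
    have := LinearMap.IsIdempotentElem.eq_zero_of_trace_eq_zero hid
      (by rw [Matrix.trace_toLin'_eq, htr])
    simpa using this
  refine ⟨m, ?_⟩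
  rw [he0, zero_add, hcomm] at h1
  calc A ^ m = A ^ m * (Polynomial.aeval A g * Polynomial.aeval A v) := by rw [h1, mul_one]
    _ = 0 := by rw [← mul_assoc, hAg, zero_mul]

/-- The left radical of the trace form on a matrix algebra. -/
def traceRadical {n : ℕ} (S : Subalgebra ℝ (Matrix (Fin n) (Fin n) ℝ)) : Ideal S where
  carrier := {a | ∀ b : S, ((a : Matrix (Fin n) (Fin n) ℝ) * b).trace = 0}
  add_mem' {a b} ha hb c := by
    rw [Subalgebra.coe_add, add_mul, Matrix.trace_add, ha, hb, add_zero]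
  zero_mem' b := by simp
  smul_mem' c a ha b := by
    have := ha (b * c)
    rw [Subalgebra.coe_mul, ← mul_assoc, Matrix.trace_mul_comm] at this
    rwa [smul_eq_mul, Subalgebra.coe_mul, mul_assoc]

instance {n : ℕ} (S : Subalgebra ℝ (Matrix (Fin n) (Fin n) ℝ)) :
    (traceRadical S).IsTwoSided where
  mul_mem_of_left {a} b ha c := by
    rw [Subalgebra.coe_mul, mul_assoc]
    exact ha (b * c)

theorem isNilpotent_traceRadical {n : ℕ} (S : Subalgebra ℝ (Matrix (Fin n) (Fin n) ℝ)) :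
    IsNilpotent (traceRadical S) := by
  have : IsArtinianRing S := IsArtinianRing.of_finite ℝ S
  obtain ⟨N, hN⟩ := IsArtinianRing.isNilpotent_jacobson_bot (R := S)
  have hle : traceRadical S ≤ Ideal.jacobson ⊥ := by
    intro x hx
    refine Ideal.mem_jacobson_iff.2 fun y => ?_
    have hyx : y * x ∈ traceRadical S := Ideal.mul_mem_left _ _ hx
    have hnil : IsNilpotent (y * x) := by
      obtain ⟨k, hk⟩ := Matrix.isNilpotent_of_trace_pow_eq_zero
        ((y * x : S) : Matrix (Fin n) (Fin n) ℝ) fun k => by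
          have := hyx ((y * x) ^ k)
          rwa [Subalgebra.coe_pow, ← pow_succ'] at this
      exact ⟨k, Subtype.ext (by simpa using hk)⟩
    obtain ⟨u, hu⟩ := hnil.isUnit_one_add
    refine ⟨↑u⁻¹, ?_⟩
    have : (↑u⁻¹ : S) * y * x + ↑u⁻¹ - 1 = 0 := by
      rw [mul_assoc, sub_eq_zero, ← mul_add_one, add_comm, ← hu, Units.inv_mul]
    rw [this]
    exact Submodule.zero_mem _
  refine ⟨N, le_antisymm (le_trans (Ideal.pow_right_mono hle N) hN.le) bot_le⟩

theorem LinearMap.exists_add_norm_le {E F V : Type*} [AddCommGroup E] [Module ℝ E]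
    [NormedAddCommGroup F] [NormedSpace ℝ F] [FiniteDimensional ℝ F]
    [NormedAddCommGroup V] [NormedSpace ℝ V] (T : E →ₗ[ℝ] F) (ψ : E →ₗ[ℝ] V) :
    ∃ C : ℝ, 0 ≤ C ∧ ∀ x : E, ∃ a b : E, T b = 0 ∧ x = a + b ∧ ‖ψ a‖ ≤ C * ‖T x‖ := by
  obtain ⟨σ, hσ⟩ := T.rangeRestrict.exists_rightInverse_of_surjective T.range_rangeRestrict
  let φ : LinearMap.range T →L[ℝ] V := LinearMap.toContinuousLinearMap (ψ ∘ₗ σ)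
  refine ⟨‖φ‖, φ.opNorm_nonneg, fun x => ⟨σ (T.rangeRestrict x), x - σ (T.rangeRestrict x), ?_,
    (add_sub_cancel _ _).symm, φ.le_opNorm (T.rangeRestrict x)⟩⟩
  have h : T (σ (T.rangeRestrict x)) = T x :=
    congrArg Subtype.val (LinearMap.congr_fun hσ (T.rangeRestrict x))
  rw [map_sub, h, sub_self]

/-- `P` is a sum of elements `x j ∈ I ^ j`, `j < N`, with `∑ j, δ ^ j * ‖x j‖ ≤ c`. -/
def HasWeightedDecomp {n : ℕ} {S : Subalgebra ℝ (Matrix (Fin n) (Fin n) ℝ)} (I : Ideal S) (N : ℕ)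
    (δ c : ℝ) (P : S) : Prop :=
  ∃ x : ℕ → S, (∀ j, x j ∈ I ^ j) ∧ P = ∑ j ∈ Finset.range N, x j ∧
    ∑ j ∈ Finset.range N, δ ^ j * ‖(x j : Matrix (Fin n) (Fin n) ℝ)‖ ≤ c

theorem HasWeightedDecomp.add_mul {n : ℕ} {S : Subalgebra ℝ (Matrix (Fin n) (Fin n) ℝ)}
    {I : Ideal S} [I.IsTwoSided] {N : ℕ} (hN : I ^ N = ⊥) {δ c K : ℝ} (hδ : 0 ≤ δ) {P a b : S}
    (hP : HasWeightedDecomp I N δ c P) (hb : b ∈ I)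
    (hK : ‖(a : Matrix (Fin n) (Fin n) ℝ)‖ + δ * ‖(b : Matrix (Fin n) (Fin n) ℝ)‖ ≤ K) :
    HasWeightedDecomp I N δ (K * c) ((a + b) * P) := by
  obtain ⟨x, hx, rfl, hc⟩ := hP
  have hK0 : 0 ≤ K := le_trans (by positivity) hK
  let z : ℕ → S := fun j => Nat.casesOn j 0 fun i => b * x i
  have hz0 : z 0 = 0 := rfl
  have hzs : ∀ i, z (i + 1) = b * x i := fun _ => rfl
  clear_value z
  have hz : ∀ j, z j ∈ I ^ j := by
    rintro (_ | i)
    · rw [hz0]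
      exact Submodule.zero_mem _
    · rw [Ideal.IsTwoSided.pow_succ, hzs]
      exact Ideal.mul_mem_mul hb (hx i)
  have hzN : z N = 0 := by
    have := hz N
    rwa [hN, Ideal.mem_bot] at this
  refine ⟨fun j => a * x j + z j, fun j => ?_, ?_, ?_⟩
  · exact Submodule.add_mem _ (Ideal.mul_mem_left _ _ (hx j)) (hz j)
  · have h := Finset.sum_range_succ z N
    rw [Finset.sum_range_succ', hzN] at h
    simp only [hz0, hzs, add_zero] at h
    rw [_root_.add_mul, Finset.mul_sum, Finset.mul_sum, Finset.sum_add_distrib, h]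
  · have h : ∑ j ∈ Finset.range N, δ ^ j * ‖(z j : Matrix (Fin n) (Fin n) ℝ)‖
        ≤ ∑ j ∈ Finset.range N, δ ^ (j + 1) *
          ‖(b * x j : Matrix (Fin n) (Fin n) ℝ)‖ := by
      have h := Finset.sum_range_succ
        (fun j => δ ^ j * ‖(z j : Matrix (Fin n) (Fin n) ℝ)‖) N
      rw [Finset.sum_range_succ'] at h
      simp only [hzN] at h
      simp only [hz0, hzs, ZeroMemClass.coe_zero, norm_zero, mul_zero, add_zero,
        Subalgebra.coe_mul] at h ⊢
      exact h.ge
    calc ∑ j ∈ Finset.range N, δ ^ j * ‖((a * x j + z j : S) : Matrix (Fin n) (Fin n) ℝ)‖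
        ≤ ∑ j ∈ Finset.range N, (δ ^ j * ‖(a * x j : Matrix (Fin n) (Fin n) ℝ)‖
            + δ ^ j * ‖(z j : Matrix (Fin n) (Fin n) ℝ)‖) := by
          refine Finset.sum_le_sum fun j _ => ?_
          rw [← mul_add]
          exact mul_le_mul_of_nonneg_left (norm_add_le _ _) (by positivity)
      _ ≤ ∑ j ∈ Finset.range N, (δ ^ j * ‖(a * x j : Matrix (Fin n) (Fin n) ℝ)‖
            + δ ^ (j + 1) * ‖(b * x j : Matrix (Fin n) (Fin n) ℝ)‖) := by
          rw [Finset.sum_add_distrib, Finset.sum_add_distrib]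
          gcongr
      _ ≤ ∑ j ∈ Finset.range N, K * (δ ^ j * ‖(x j : Matrix (Fin n) (Fin n) ℝ)‖) := by
          refine Finset.sum_le_sum fun j _ => ?_
          calc _ ≤ δ ^ j * (‖(a : Matrix (Fin n) (Fin n) ℝ)‖ * ‖(x j : Matrix (Fin n) (Fin n) ℝ)‖)
                + δ ^ (j + 1) * (‖(b : Matrix (Fin n) (Fin n) ℝ)‖ *
                  ‖(x j : Matrix (Fin n) (Fin n) ℝ)‖) := by
                gcongr <;> exact Matrix.frobenius_norm_mul _ _
            _ = (‖(a : Matrix (Fin n) (Fin n) ℝ)‖ + δ * ‖(b : Matrix (Fin n) (Fin n) ℝ)‖) *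
                (δ ^ j * ‖(x j : Matrix (Fin n) (Fin n) ℝ)‖) := by ring
            _ ≤ _ := by gcongr
      _ ≤ K * c := by
          rw [← Finset.mul_sum]
          gcongr

theorem HasWeightedDecomp.norm_le {n : ℕ} {S : Subalgebra ℝ (Matrix (Fin n) (Fin n) ℝ)}
    {I : Ideal S} {N : ℕ} {δ c : ℝ} (hδ : 0 < δ) (hδ1 : δ ≤ 1) {P : S}
    (hP : HasWeightedDecomp I N δ c P) :
    ‖(P : Matrix (Fin n) (Fin n) ℝ)‖ ≤ (δ ^ N)⁻¹ * c := by
  obtain ⟨x, -, rfl, hc⟩ := hP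
  rw [← div_eq_inv_mul, le_div_iff₀ (by positivity), mul_comm]
  refine le_trans ?_ hc
  rw [AddSubmonoidClass.coe_finsetSum]
  calc δ ^ N * ‖∑ j ∈ Finset.range N, (x j : Matrix (Fin n) (Fin n) ℝ)‖
      ≤ δ ^ N * ∑ j ∈ Finset.range N, ‖(x j : Matrix (Fin n) (Fin n) ℝ)‖ := by
        gcongr
        exact norm_sum_le _ _
    _ ≤ _ := by
        rw [Finset.mul_sum]
        refine Finset.sum_le_sum fun j hj => ?_
        exact mul_le_mul_of_nonneg_right
          (pow_le_pow_of_le_one hδ.le hδ1 (Finset.mem_range.1 hj).le) (norm_nonneg _)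

theorem hasWeightedDecomp_one {n : ℕ} {S : Subalgebra ℝ (Matrix (Fin n) (Fin n) ℝ)} {I : Ideal S}
    {N : ℕ} (hN : I ^ N = ⊥) {δ : ℝ} :
    HasWeightedDecomp I N δ ‖(1 : Matrix (Fin n) (Fin n) ℝ)‖ (1 : S) := by
  rcases N with _ | N
  · have h : (1 : S) ∈ I ^ 0 := by
      rw [Submodule.pow_zero, Ideal.one_eq_top]
      exact Submodule.mem_top
    rw [hN, Ideal.mem_bot] at h
    exact ⟨0, fun _ => Submodule.zero_mem _, by simpa using h, by simp⟩
  · refine ⟨fun j => Nat.casesOn j 1 fun _ => 0, ?_, ?_, ?_⟩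
    · rintro (_ | j)
      · rw [Submodule.pow_zero, Ideal.one_eq_top]
        exact Submodule.mem_top
      · exact Submodule.zero_mem _
    · simp [Finset.sum_range_succ']
    · simp [Finset.sum_range_succ']

theorem eventually_const_mul_pow_le {r s : ℝ} (hr : 0 < r) (hrs : r < s) (C : ℝ) :
    ∀ᶠ k : ℕ in atTop, C * r ^ k ≤ s ^ k := by
  filter_upwards [(tendsto_pow_atTop_atTop_of_one_lt ((one_lt_div hr).2 hrs)).eventually_ge_atTop C]
    with k hk
  rwa [div_pow, le_div_iff₀ (by positivity)] at hk

theorem specRad_nonneg {n : ℕ} (P : Matrix (Fin n) (Fin n) ℝ) : 0 ≤ specRad P :=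
  ENNReal.toReal_nonneg

theorem spectralRadius_map_le {n : ℕ} (P : Matrix (Fin n) (Fin n) ℝ) :
    spectralRadius ℂ (P.map (algebraMap ℝ ℂ)) ≤
      ENNReal.ofReal (‖P‖ * ‖(1 : Matrix (Fin n) (Fin n) ℝ)‖) := by
  let _ : NormedRing (Matrix (Fin n) (Fin n) ℂ) := Matrix.frobeniusNormedRing
  let _ : NormedAlgebra ℂ (Matrix (Fin n) (Fin n) ℂ) := Matrix.frobeniusNormedAlgebra
  have hmap : ∀ A : Matrix (Fin n) (Fin n) ℝ, ‖A.map (algebraMap ℝ ℂ)‖ = ‖A‖ := fun A =>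
    Matrix.frobenius_norm_map_eq A _ fun a => by simp
  refine iSup₂_le fun z hz => ?_
  have : CompleteSpace (Matrix (Fin n) (Fin n) ℂ) := FiniteDimensional.complete ℂ _
  have h := spectrum.norm_le_norm_mul_of_mem hz
  have h1 := hmap 1
  rw [Matrix.map_one _ (map_zero _) (map_one _)] at h1
  rw [hmap, h1] at h
  refine le_trans (le_of_eq ?_) (ENNReal.ofReal_le_ofReal h)
  exact (ofReal_norm z).symm

theorem specRad_le {n : ℕ} (P : Matrix (Fin n) (Fin n) ℝ) :
    specRad P ≤ ‖P‖ * ‖(1 : Matrix (Fin n) (Fin n) ℝ)‖ :=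
  ENNReal.toReal_le_of_le_ofReal (by positivity) (spectralRadius_map_le P)

theorem norm_le_specRad {n : ℕ} (P : Matrix (Fin n) (Fin n) ℝ) {z : ℂ}
    (hz : z ∈ spectrum ℂ (P.map (algebraMap ℝ ℂ))) : ‖z‖ ≤ specRad P := by
  have h : (‖z‖₊ : ENNReal) ≤ spectralRadius ℂ (P.map (algebraMap ℝ ℂ)) :=
    le_iSup₂ (f := fun (k : ℂ) (_ : k ∈ spectrum ℂ (P.map (algebraMap ℝ ℂ))) =>
      (‖k‖₊ : ENNReal)) z hz
  have := ENNReal.toReal_mono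
    (ne_top_of_le_ne_top ENNReal.ofReal_ne_top (spectralRadius_map_le P)) h
  rwa [ENNReal.coe_toReal, coe_nnnorm] at this

theorem abs_trace_le_specRad {n : ℕ} (P : Matrix (Fin n) (Fin n) ℝ) :
    |P.trace| ≤ n * specRad P := by
  set Q := P.map (algebraMap ℝ ℂ) with hQ
  have htr : (P.trace : ℂ) = Q.charpoly.roots.sum := by
    rw [← Matrix.trace_eq_sum_roots_charpoly, hQ]
    simp [Matrix.trace]
  have hcard : (Q.charpoly.roots.map fun z => ‖z‖).card ≤ n := by
    rw [Multiset.card_map]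
    refine (Polynomial.card_roots' _).trans ?_
    rw [Matrix.charpoly_natDegree_eq_dim, Fintype.card_fin]
  calc |P.trace| = ‖(P.trace : ℂ)‖ := by simp
    _ ≤ (Q.charpoly.roots.map fun z => ‖z‖).sum := by
        rw [htr]
        exact norm_multiset_sum_le _
    _ ≤ (Q.charpoly.roots.map fun z => ‖z‖).card • specRad P := by
        refine Multiset.sum_le_card_nsmul _ _ fun y hy => ?_
        obtain ⟨z, hz, rfl⟩ := Multiset.mem_map.1 hy
        exact norm_le_specRad P (Matrix.mem_spectrum_of_isRoot_charpoly
          (Polynomial.isRoot_of_mem_roots hz))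
    _ ≤ n * specRad P := by
        rw [nsmul_eq_mul]
        exact mul_le_mul_of_nonneg_right (by exact_mod_cast hcard) (specRad_nonneg P)

section prodsLen

variable {n : ℕ} {M : Set (Matrix (Fin n) (Fin n) ℝ)}

theorem prodsLen_nonempty (hM : M.Nonempty) (k : ℕ) : (prodsLen M k).Nonempty := by
  obtain ⟨A, hA⟩ := hM
  exact ⟨_, List.replicate k A, List.length_replicate,
    fun B hB => List.eq_of_mem_replicate hB ▸ hA, rfl⟩

theorem mul_mem_prodsLen {k l : ℕ} {P Q : Matrix (Fin n) (Fin n) ℝ} (hP : P ∈ prodsLen M k)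
    (hQ : Q ∈ prodsLen M l) : P * Q ∈ prodsLen M (k + l) := by
  obtain ⟨p, rfl, hp, rfl⟩ := hP
  obtain ⟨q, rfl, hq, rfl⟩ := hQ
  refine ⟨p ++ q, List.length_append, fun A hA => ?_, List.prod_append.symm⟩
  exact (List.mem_append.1 hA).elim (hp A) (hq A)

theorem exists_mul_of_mem_prodsLen_add {k l : ℕ} {P : Matrix (Fin n) (Fin n) ℝ}
    (hP : P ∈ prodsLen M (k + l)) : ∃ Q ∈ prodsLen M k, ∃ R ∈ prodsLen M l, P = Q * R := by
  obtain ⟨p, hp, hM, rfl⟩ := hP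
  refine ⟨_, ⟨p.take k, by simp [hp], fun A hA => hM A (List.mem_of_mem_take hA), rfl⟩,
    _, ⟨p.drop k, by simp [hp], fun A hA => hM A (List.mem_of_mem_drop hA), rfl⟩, ?_⟩
  rw [← List.prod_append, List.take_append_drop]

theorem mem_closure_iff_mem_prodsLen {P : Matrix (Fin n) (Fin n) ℝ} :
    P ∈ Submonoid.closure M ↔ ∃ k, P ∈ prodsLen M k := by
  constructor
  · intro h
    obtain ⟨l, hl, rfl⟩ := Submonoid.exists_list_of_mem_closure h
    exact ⟨_, l, rfl, hl, rfl⟩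
  · rintro ⟨_, l, -, hl, rfl⟩
    exact Submonoid.list_prod_mem _ fun A hA => Submonoid.subset_closure (hl A hA)

theorem norm_le_of_mem_prodsLen {B : ℝ} (hB : ∀ A ∈ M, ‖A‖ ≤ B) (hB0 : 0 ≤ B) {k : ℕ}
    {P : Matrix (Fin n) (Fin n) ℝ} (hP : P ∈ prodsLen M k) :
    ‖P‖ ≤ B ^ k * ‖(1 : Matrix (Fin n) (Fin n) ℝ)‖ := by
  obtain ⟨p, rfl, hp, rfl⟩ := hP
  induction p with
  | nil => simp
  | cons A p ih =>
    rw [List.prod_cons, List.length_cons, pow_succ', mul_assoc]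
    refine (Matrix.frobenius_norm_mul _ _).trans ?_
    exact mul_le_mul (hB A (hp A List.mem_cons_self))
      (ih fun C hC => hp C (List.mem_cons_of_mem _ hC)) (norm_nonneg _) hB0

theorem mem_adjoin_of_mem_prodsLen {k : ℕ} {P : Matrix (Fin n) (Fin n) ℝ}
    (hP : P ∈ prodsLen M k) : P ∈ Algebra.adjoin ℝ M := by
  obtain ⟨p, -, hp, rfl⟩ := hP
  exact Subalgebra.list_prod_mem _ fun A hA => Algebra.subset_adjoin (hp A hA)

/-- If the spectral radii of long products are dominated by `r ^ k`, then long products are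
dominated by `r ^ k` modulo the radical of the trace form. -/
theorem exists_add_traceRadical {r : ℝ} (hr : 0 < r)
    (h : ∀ᶠ k in atTop, ∀ P ∈ prodsLen M k, specRad P ≤ r ^ k) :
    ∃ C : ℝ, 0 < C ∧ ∀ᶠ k in atTop, ∀ P : Algebra.adjoin ℝ M,
      (P : Matrix (Fin n) (Fin n) ℝ) ∈ prodsLen M k →
      ∃ a b : Algebra.adjoin ℝ M, b ∈ traceRadical (Algebra.adjoin ℝ M) ∧ P = a + b ∧
        ‖(a : Matrix (Fin n) (Fin n) ℝ)‖ ≤ C * r ^ k := by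
  set S := Algebra.adjoin ℝ M
  obtain ⟨t, htM, ht⟩ := (Submodule.fg_span_iff_fg_span_finset_subset
    (R := ℝ) (Submonoid.closure M : Set (Matrix (Fin n) (Fin n) ℝ))).1
    (IsNoetherian.noetherian _)
  have hlen : ∀ b : t, ∃ l, (b : Matrix (Fin n) (Fin n) ℝ) ∈ prodsLen M l := fun b =>
    mem_closure_iff_mem_prodsLen.1 (htM b.2)
  choose l hl using hlen
  let T : S →ₗ[ℝ] (t → ℝ) := LinearMap.pi fun b =>
    Matrix.traceLinearMap (Fin n) ℝ ℝ ∘ₗ LinearMap.mulRight ℝ (b : Matrix (Fin n) (Fin n) ℝ) ∘ₗ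
      S.val.toLinearMap
  have hT : ∀ (x : S) (b : t), T x b = ((x : Matrix (Fin n) (Fin n) ℝ) * b).trace :=
    fun _ _ => rfl
  have hker : ∀ x : S, T x = 0 → x ∈ traceRadical S := by
    intro x hx b
    have hb : (b : Matrix (Fin n) (Fin n) ℝ) ∈ Submodule.span ℝ (t : Set _) := by
      rw [← ht, ← Algebra.adjoin_eq_span]
      exact b.2
    obtain ⟨b, hbS⟩ := b
    simp only at hb ⊢
    clear hbS
    induction hb using Submodule.span_induction with
    | mem y hy => rw [← hT x ⟨y, hy⟩, hx, Pi.zero_apply]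
    | zero => simp
    | add y z _ _ hy hz => rw [mul_add, Matrix.trace_add, hy, hz, add_zero]
    | smul c y _ hy => rw [mul_smul_comm, Matrix.trace_smul, hy, smul_zero]
  let _ : NormedSpace ℝ (Matrix (Fin n) (Fin n) ℝ) := Matrix.frobeniusNormedSpace
  obtain ⟨C, hC, hdec⟩ := T.exists_add_norm_le S.val.toLinearMap
  obtain ⟨D, hD0, hD⟩ : ∃ D : ℝ, 0 ≤ D ∧ ∀ b : t, r ^ l b ≤ D :=
    ⟨∑ b, r ^ l b, by positivity, fun b =>
      Finset.single_le_sum (f := fun b => r ^ l b) (fun _ _ => by positivity) (Finset.mem_univ b)⟩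
  refine ⟨C * (n * D) + 1, by positivity, ?_⟩
  obtain ⟨k₀, hk₀⟩ := eventually_atTop.1 h
  filter_upwards [eventually_ge_atTop k₀] with k hk P hP
  obtain ⟨a, b, hb, hab, hle⟩ := hdec P
  refine ⟨a, b, hker b hb, hab, hle.trans ?_⟩
  have hTP : ‖T P‖ ≤ n * D * r ^ k := by
    refine (pi_norm_le_iff_of_nonneg (by positivity)).2 fun b => ?_
    rw [hT, Real.norm_eq_abs]
    calc _ ≤ n * specRad ((P : Matrix (Fin n) (Fin n) ℝ) * (b : Matrix (Fin n) (Fin n) ℝ)) :=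
          abs_trace_le_specRad _
      _ ≤ n * r ^ (k + l b) := by
          gcongr
          exact hk₀ _ (by omega) _ (mul_mem_prodsLen hP (hl b))
      _ = n * r ^ l b * r ^ k := by ring
      _ ≤ n * D * r ^ k := by
          gcongr
          exact hD b
  calc C * ‖T P‖ ≤ C * (n * D * r ^ k) := by gcongr
    _ ≤ (C * (n * D) + 1) * r ^ k := by nlinarith [pow_pos hr k]

/-- If the spectral radii of long products are dominated by `r ^ k`, then their norms grow no
faster than `s ^ k`, for every `s > r`. -/
theorem exists_norm_le_pow_of_specRad_le {B r s : ℝ} (hB : ∀ A ∈ M, ‖A‖ ≤ B) (hB0 : 0 ≤ B)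
    (hr : 0 < r) (hrs : r < s) (h : ∀ᶠ k in atTop, ∀ P ∈ prodsLen M k, specRad P ≤ r ^ k) :
    ∃ C : ℝ, ∀ k, ∀ P ∈ prodsLen M k, ‖P‖ ≤ C * s ^ k := by
  obtain ⟨C, hC, hdec⟩ := exists_add_traceRadical hr h
  obtain ⟨N, hN⟩ := isNilpotent_traceRadical (Algebra.adjoin ℝ M)
  have hs : 0 < s := hr.trans hrs
  obtain ⟨m, hm0, hmdec, hms⟩ := ((eventually_gt_atTop 0).and
    (hdec.and (eventually_const_mul_pow_le hr hrs (2 * C)))).exists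
  set E : ℝ := ‖(1 : Matrix (Fin n) (Fin n) ℝ)‖
  have hE0 : 0 ≤ E := norm_nonneg _
  set K : ℝ := B ^ m * E + C * r ^ m
  have hK0 : 0 < K := by positivity
  set δ : ℝ := min 1 (C * r ^ m / K)
  have hδ0 : 0 < δ := lt_min one_pos (by positivity)
  have hδK : δ * K ≤ C * r ^ m := (le_div_iff₀ hK0).1 (min_le_right _ _)
  have hblock : ∀ L : ℕ, ∀ P : Algebra.adjoin ℝ M,
      (P : Matrix (Fin n) (Fin n) ℝ) ∈ prodsLen M (m * L) →
      HasWeightedDecomp (traceRadical (Algebra.adjoin ℝ M)) N δ ((s ^ m) ^ L * E) P := by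
    intro L
    induction L with
    | zero =>
      rintro ⟨P, hPS⟩ hP
      obtain ⟨p, hp, -, rfl⟩ := hP
      obtain rfl := List.length_eq_zero_iff.1 (hp.trans (mul_zero m))
      rw [pow_zero, one_mul]
      exact hasWeightedDecomp_one hN
    | succ L ih =>
      rintro ⟨P, hPS⟩ hP
      rw [mul_add_one, add_comm] at hP
      obtain ⟨Q, hQ, R, hR, rfl⟩ := exists_mul_of_mem_prodsLen_add hP
      have hQS := mem_adjoin_of_mem_prodsLen hQ
      have hRS := mem_adjoin_of_mem_prodsLen hR
      obtain ⟨a, b, hb, hab, ha⟩ := hmdec ⟨Q, hQS⟩ hQ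
      have hbK : ‖(b : Matrix (Fin n) (Fin n) ℝ)‖ ≤ K := by
        have : (b : Matrix (Fin n) (Fin n) ℝ) = Q - a := by
          rw [eq_sub_iff_add_eq', ← Subalgebra.coe_add, ← hab]
        rw [this]
        exact (norm_sub_le _ _).trans (add_le_add (norm_le_of_mem_prodsLen hB hB0 hQ) ha)
      have hPQ : (⟨Q * R, hPS⟩ : Algebra.adjoin ℝ M) = (a + b) * ⟨R, hRS⟩ := by
        rw [← hab]
        rfl
      rw [hPQ, pow_succ', mul_assoc]
      refine (ih ⟨R, hRS⟩ hR).add_mul hN hδ0.le hb ?_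
      have := mul_le_mul_of_nonneg_left hbK hδ0.le
      linarith
  obtain ⟨D, hD0, hD⟩ : ∃ D : ℝ, 0 ≤ D ∧ ∀ q < m, B ^ q * E ≤ D * s ^ q := by
    refine ⟨∑ q ∈ Finset.range m, B ^ q * E / s ^ q, by positivity, fun q hq => ?_⟩
    rw [← div_le_iff₀ (by positivity)]
    exact Finset.single_le_sum (f := fun q => B ^ q * E / s ^ q) (fun _ _ => by positivity)
      (Finset.mem_range.2 hq)
  refine ⟨(δ ^ N)⁻¹ * E * D, fun k P hP => ?_⟩
  rw [← Nat.div_add_mod k m] at hP ⊢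
  obtain ⟨Q, hQ, R, hR, rfl⟩ := exists_mul_of_mem_prodsLen_add hP
  have h1 := (hblock _ ⟨Q, mem_adjoin_of_mem_prodsLen hQ⟩ hQ).norm_le hδ0 (min_le_left _ _)
  have h2 := (norm_le_of_mem_prodsLen hB hB0 hR).trans (hD _ (Nat.mod_lt k hm0))
  calc ‖Q * R‖ ≤ ‖Q‖ * ‖R‖ := Matrix.frobenius_norm_mul _ _
    _ ≤ ((δ ^ N)⁻¹ * ((s ^ m) ^ (k / m) * E)) * (D * s ^ (k % m)) := by gcongr
    _ = _ := by
      rw [pow_add, pow_mul]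
      ring

/-- The limit superior of the suprema of `f P ^ (1 / k)` over products `P` of length `k`. -/
noncomputable def growthRate (M : Set (Matrix (Fin n) (Fin n) ℝ))
    (f : Matrix (Fin n) (Fin n) ℝ → ℝ) : ℝ :=
  limsup (fun k : ℕ => sSup ((fun P => f P ^ ((1:ℝ)/k)) '' prodsLen M k)) atTop

theorem sSup_image_rpow_nonneg {f : Matrix (Fin n) (Fin n) ℝ → ℝ} (hf : ∀ P, 0 ≤ f P) (k : ℕ) :
    0 ≤ sSup ((fun P => f P ^ ((1:ℝ)/k)) '' prodsLen M k) :=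
  Real.sSup_nonneg (by
    rintro _ ⟨P, -, rfl⟩
    exact Real.rpow_nonneg (hf P) _)

theorem rpow_one_div_le_of_le_pow {x t : ℝ} {k : ℕ} (hk : 0 < k) (hx : 0 ≤ x) (ht : 0 ≤ t)
    (h : x ≤ t ^ k) : x ^ ((1:ℝ)/k) ≤ t := by
  rw [one_div]
  exact (Real.rpow_le_rpow hx h (by positivity)).trans_eq (Real.pow_rpow_inv_natCast ht hk.ne')

theorem sSup_image_rpow_le {f : Matrix (Fin n) (Fin n) ℝ → ℝ} (hf : ∀ P, 0 ≤ f P) {t : ℝ}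
    (ht : 0 ≤ t) {k : ℕ} (hk : 0 < k) (h : ∀ P ∈ prodsLen M k, f P ≤ t ^ k) :
    sSup ((fun P => f P ^ ((1:ℝ)/k)) '' prodsLen M k) ≤ t := by
  refine Real.sSup_le ?_ ht
  rintro _ ⟨P, hP, rfl⟩
  exact rpow_one_div_le_of_le_pow hk (hf P) ht (h P hP)

theorem growthRate_nonneg {f : Matrix (Fin n) (Fin n) ℝ → ℝ} (hf : ∀ P, 0 ≤ f P) {B : ℝ}
    (hB0 : 0 ≤ B) (hB : ∀ᶠ k in atTop, ∀ P ∈ prodsLen M k, f P ≤ B ^ k) : 0 ≤ growthRate M f := by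
  refine le_limsup_of_frequently_le (Frequently.of_forall fun k => sSup_image_rpow_nonneg hf k)
    ⟨B, ?_⟩
  rw [eventually_map]
  filter_upwards [hB, eventually_gt_atTop 0] with k hk hk0
  exact sSup_image_rpow_le hf hB0 hk0 hk

theorem growthRate_le {f : Matrix (Fin n) (Fin n) ℝ → ℝ} (hf : ∀ P, 0 ≤ f P) {t : ℝ}
    (ht : 0 ≤ t) (h : ∀ᶠ k in atTop, ∀ P ∈ prodsLen M k, f P ≤ t ^ k) : growthRate M f ≤ t := by
  refine limsup_le_of_le (isCoboundedUnder_le_of_le atTop fun k => sSup_image_rpow_nonneg hf k) ?_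
  filter_upwards [h, eventually_gt_atTop 0] with k hk hk0
  exact sSup_image_rpow_le hf ht hk0 hk

theorem eventually_le_pow_of_growthRate_lt {f : Matrix (Fin n) (Fin n) ℝ → ℝ}
    (hf : ∀ P, 0 ≤ f P) {B : ℝ} (hB0 : 0 ≤ B)
    (hB : ∀ᶠ k in atTop, ∀ P ∈ prodsLen M k, f P ≤ B ^ k) {t : ℝ} (h : growthRate M f < t) :
    ∀ᶠ k in atTop, ∀ P ∈ prodsLen M k, f P ≤ t ^ k := by
  have hbdd : IsBoundedUnder (· ≤ ·) atTop
      (fun k : ℕ => sSup ((fun P => f P ^ ((1:ℝ)/k)) '' prodsLen M k)) := by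
    refine ⟨B, ?_⟩
    rw [eventually_map]
    filter_upwards [hB, eventually_gt_atTop 0] with k hk hk0
    exact sSup_image_rpow_le hf hB0 hk0 hk
  filter_upwards [hB, eventually_gt_atTop 0, eventually_lt_of_limsup_lt h hbdd] with k hk hk0 hlt
    P hP
  have hle : f P ^ ((1:ℝ)/k) ≤ t := by
    refine (le_csSup ⟨B, ?_⟩ (Set.mem_image_of_mem _ hP)).trans hlt.le
    rintro _ ⟨Q, hQ, rfl⟩
    exact rpow_one_div_le_of_le_pow hk0 (hf Q) hB0 (hk Q hQ)
  rw [one_div] at hle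
  calc f P = (f P ^ ((k:ℝ)⁻¹)) ^ k := (Real.rpow_inv_natCast_pow (hf P) hk0.ne').symm
    _ ≤ t ^ k := pow_le_pow_left₀ (Real.rpow_nonneg (hf P) _) hle k

theorem growthRate_le_growthRate {f g : Matrix (Fin n) (Fin n) ℝ → ℝ} (hf : ∀ P, 0 ≤ f P)
    (hg : ∀ P, 0 ≤ g P) {B : ℝ} (hB0 : 0 ≤ B)
    (hB : ∀ᶠ k in atTop, ∀ P ∈ prodsLen M k, g P ≤ B ^ k)
    (h : ∀ r s : ℝ, 0 < r → r < s → (∀ᶠ k in atTop, ∀ P ∈ prodsLen M k, g P ≤ r ^ k) →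
      ∃ C : ℝ, ∀ᶠ k in atTop, ∀ P ∈ prodsLen M k, f P ≤ C * s ^ k) :
    growthRate M f ≤ growthRate M g := by
  refine le_of_forall_gt_imp_ge_of_dense fun t ht => ?_
  have h0 := growthRate_nonneg hg hB0 hB
  obtain ⟨r, hgr, hrt⟩ := exists_between ht
  obtain ⟨s, hrs, hst⟩ := exists_between hrt
  have hr : 0 < r := h0.trans_lt hgr
  obtain ⟨C, hC⟩ := h r s hr hrs (eventually_le_pow_of_growthRate_lt hg hB0 hB hgr)
  refine growthRate_le hf (h0.trans ht.le) ?_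
  filter_upwards [eventually_const_mul_pow_le (hr.trans hrs) hst C, hC] with k hk hCk P hP
  exact (hCk P hP).trans hk

end prodsLen

/-- Berger–Wang: the generalized spectral radius equals the joint
spectral radius for finite nonempty sets of matrices. -/
theorem stmt8 {n : ℕ} (M : Set (Matrix (Fin n) (Fin n) ℝ))
    (hMfin : M.Finite) (hMne : M.Nonempty) :
    limsup (fun k : ℕ => sSup ((fun P => specRad P ^ ((1:ℝ)/k)) '' prodsLen M k))
      atTop = jsr M := by
  change growthRate M specRad = growthRate M (fun P => ‖P‖)
  obtain ⟨A, hA⟩ := hMne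
  obtain ⟨B, hB⟩ := (hMfin.image fun A => ‖A‖).bddAbove
  replace hB : ∀ A ∈ M, ‖A‖ ≤ B := fun A hA => hB (Set.mem_image_of_mem _ hA)
  have hB0 : 0 ≤ B := (norm_nonneg A).trans (hB A hA)
  set E : ℝ := ‖(1 : Matrix (Fin n) (Fin n) ℝ)‖
  have hnorm : ∀ᶠ k in atTop, ∀ P ∈ prodsLen M k, ‖P‖ ≤ (B + 2) ^ k := by
    filter_upwards [eventually_const_mul_pow_le (show 0 < B + 1 by linarith)
      (show B + 1 < B + 2 by linarith) E] with k hk P hP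
    refine (norm_le_of_mem_prodsLen hB hB0 hP).trans (le_trans ?_ hk)
    rw [mul_comm]
    gcongr
    linarith
  have hspec : ∀ᶠ k in atTop, ∀ P ∈ prodsLen M k, specRad P ≤ (B + 3) ^ k := by
    filter_upwards [hnorm, eventually_const_mul_pow_le (show 0 < B + 2 by linarith)
      (show B + 2 < B + 3 by linarith) E] with k hk hk' P hP
    refine (specRad_le P).trans (le_trans ?_ hk')
    rw [mul_comm]
    gcongr
    exact hk P hP
  refine le_antisymm ?_ ?_
  · refine growthRate_le_growthRate specRad_nonneg (fun P => norm_nonneg P) (by linarith) hnorm ?_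
    refine fun r s hr hrs h => ⟨E, ?_⟩
    filter_upwards [h] with k hk P hP
    rw [mul_comm]
    refine (specRad_le P).trans ?_
    gcongr
    exact (hk P hP).trans (pow_le_pow_left₀ hr.le hrs.le k)
  · exact growthRate_le_growthRate (fun P => norm_nonneg P) specRad_nonneg (by linarith) hspec
      fun r s hr hrs h =>
        (exists_norm_le_pow_of_specRad_le hB hB0 hr hrs h).imp fun _ hC => .of_forall hC
end

section
/- For a finite nonempty set M of real n×n matrices, the joint spectral radius equals the infimum, over all norms ν on ℝ^n, of the maximum over A ∈ M of the operator norm of A induced by ν: ρ̂(M) = inf_ν max_{A∈M} sup_{x≠0} ν(Ax)/ν(x). -/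
open Matrix Filter

attribute [local instance] Matrix.frobeniusNormedAddCommGroup

/-- `ν` is a norm on `ℝ^n`. -/
def IsNormOn {n : ℕ} (ν : (Fin n → ℝ) → ℝ) : Prop :=
  (∀ x, ν x = 0 ↔ x = 0) ∧ (∀ (c : ℝ) x, ν (c • x) = |c| * ν x) ∧
    (∀ x y, ν (x + y) ≤ ν x + ν y)

/-- The operator norm of a matrix induced by the vector norm `ν`,
`sup_{x ≠ 0} ν(Ax)/ν(x)`. -/
noncomputable def opNormOf {n : ℕ} (ν : (Fin n → ℝ) → ℝ)
    (A : Matrix (Fin n) (Fin n) ℝ) : ℝ :=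
  sSup {t : ℝ | ∃ x : Fin n → ℝ, x ≠ 0 ∧ t = ν (A.mulVec x) / ν x}

theorem frobenius_entry_le {n : ℕ} (A : Matrix (Fin n) (Fin n) ℝ) (i j : Fin n) :
    |A i j| ≤ ‖A‖ := by
  rw [Matrix.frobenius_norm_def, ← Real.sqrt_eq_rpow]
  apply Real.le_sqrt_of_sq_le
  have h1 : |A i j| ^ 2 ≤ ∑ j, ‖A i j‖ ^ (2 : ℝ) := by
    have := Finset.single_le_sum (f := fun j => ‖A i j‖ ^ (2 : ℝ))
      (fun j _ => by positivity) (Finset.mem_univ j)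
    simpa using this
  exact h1.trans (Finset.single_le_sum (f := fun i => ∑ j, ‖A i j‖ ^ (2 : ℝ))
      (fun j _ => by positivity) (Finset.mem_univ i))

theorem frobenius_le_of_entry_le {n : ℕ} (A : Matrix (Fin n) (Fin n) ℝ) {b : ℝ} (hb : 0 ≤ b)
    (h : ∀ i j, |A i j| ≤ b) : ‖A‖ ≤ n * b := by
  rw [Matrix.frobenius_norm_def, ← Real.sqrt_eq_rpow]
  apply Real.sqrt_le_iff.2 ⟨by positivity, ?_⟩
  calc ∑ i, ∑ j, ‖A i j‖ ^ (2 : ℝ) ≤ ∑ _i : Fin n, ∑ _j : Fin n, b ^ 2 := by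
        gcongr with i _ j _
        rw [Real.rpow_two, Real.norm_eq_abs]
        gcongr
        exact h i j
    _ = (n * b) ^ 2 := by simp; ring

theorem norm_mulVec_le_frobenius {n : ℕ} (A : Matrix (Fin n) (Fin n) ℝ) (x : Fin n → ℝ) :
    ‖A.mulVec x‖ ≤ n * ‖A‖ * ‖x‖ := by
  refine (pi_norm_le_iff_of_nonneg (by positivity)).2 fun i => ?_
  calc ‖A.mulVec x i‖ ≤ ∑ j, ‖A i j * x j‖ := by
        exact norm_sum_le Finset.univ fun j => A i j * x j
    _ ≤ ∑ _j : Fin n, ‖A‖ * ‖x‖ := by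
        gcongr with j
        rw [norm_mul]
        gcongr
        · exact frobenius_entry_le A i j
        · exact norm_le_pi_norm x j
    _ = n * ‖A‖ * ‖x‖ := by simp; ring

namespace IsNormOn

variable {n : ℕ} {ν : (Fin n → ℝ) → ℝ}

theorem nonneg (h : IsNormOn ν) (x : Fin n → ℝ) : 0 ≤ ν x := by
  have h1 := h.2.2 x ((-1 : ℝ) • x)
  rw [h.2.1, neg_one_smul, add_neg_cancel, (h.1 0).2 rfl] at h1
  simp at h1
  linarith

theorem pos (h : IsNormOn ν) {x : Fin n → ℝ} (hx : x ≠ 0) : 0 < ν x :=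
  (h.nonneg x).lt_of_ne fun h0 => hx ((h.1 x).1 h0.symm)

theorem convexOn (h : IsNormOn ν) : ConvexOn ℝ Set.univ ν := by
  refine ⟨convex_univ, fun x _ y _ a b ha hb _ => (h.2.2 _ _).trans ?_⟩
  rw [h.2.1, h.2.1, abs_of_nonneg ha, abs_of_nonneg hb]
  simp

theorem continuous (h : IsNormOn ν) : Continuous ν :=
  continuousOn_univ.1 (h.convexOn.continuousOn isOpen_univ)

theorem map_eq_norm_mul (h : IsNormOn ν) {x : Fin n → ℝ} (hx : x ≠ 0) :
    ν x = ‖x‖ * ν (‖x‖⁻¹ • x) := by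
  have : ‖x‖ ≠ 0 := norm_ne_zero_iff.2 hx
  rw [h.2.1, abs_of_nonneg (by positivity)]
  field_simp

theorem exists_bounds (h : IsNormOn ν) :
    ∃ m > 0, ∃ U > 0, ∀ x, m * ‖x‖ ≤ ν x ∧ ν x ≤ U * ‖x‖ := by
  have hc : IsCompact (Metric.sphere (0 : Fin n → ℝ) 1) := isCompact_sphere 0 1
  rcases (Metric.sphere (0 : Fin n → ℝ) 1).eq_empty_or_nonempty with he | hne
  · have hz : ∀ x : Fin n → ℝ, x = 0 := by
      intro x
      by_contra hx
      have : ‖x‖⁻¹ • x ∈ Metric.sphere (0 : Fin n → ℝ) 1 := by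
        simp [norm_smul, hx]
      simp [he] at this
    refine ⟨1, one_pos, 1, one_pos, fun x => ?_⟩
    rw [hz x, (h.1 0).2 rfl]
    simp
  · obtain ⟨a, ha, hamin⟩ := hc.exists_isMinOn hne h.continuous.continuousOn
    obtain ⟨b, hb, hbmax⟩ := hc.exists_isMaxOn hne h.continuous.continuousOn
    have h0 : ∀ y ∈ Metric.sphere (0 : Fin n → ℝ) 1, y ≠ 0 := by
      rintro y hy rfl
      simp at hy
    refine ⟨ν a, h.pos (h0 a ha), ν b, h.pos (h0 b hb), fun x => ?_⟩
    by_cases hx : x = 0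
    · rw [hx, (h.1 0).2 rfl]
      simp
    · have hs : ‖x‖⁻¹ • x ∈ Metric.sphere (0 : Fin n → ℝ) 1 := by
        simp [norm_smul, hx]
      rw [h.map_eq_norm_mul hx, mul_comm, mul_comm (ν b)]
      exact ⟨mul_le_mul_of_nonneg_left (hamin hs) (norm_nonneg _),
        mul_le_mul_of_nonneg_left (hbmax hs) (norm_nonneg _)⟩

theorem opNormOf_nonneg (h : IsNormOn ν) (A : Matrix (Fin n) (Fin n) ℝ) : 0 ≤ opNormOf ν A := by
  refine Real.sSup_nonneg ?_
  rintro t ⟨x, -, rfl⟩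
  exact div_nonneg (h.nonneg _) (h.nonneg _)

theorem le_opNormOf (h : IsNormOn ν) (A : Matrix (Fin n) (Fin n) ℝ) (x : Fin n → ℝ) :
    ν (A.mulVec x) ≤ opNormOf ν A * ν x := by
  by_cases hx : x = 0
  · rw [hx, Matrix.mulVec_zero, (h.1 0).2 rfl]
    simp
  rw [← div_le_iff₀ (h.pos hx)]
  refine le_csSup ?_ ⟨x, hx, rfl⟩
  obtain ⟨m, hm, U, hU, hb⟩ := h.exists_bounds
  refine ⟨U * (n * ‖A‖) / m, ?_⟩
  rintro t ⟨y, hy, rfl⟩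
  rw [div_le_div_iff₀ (h.pos hy) hm]
  calc ν (A.mulVec y) * m ≤ (U * (n * ‖A‖ * ‖y‖)) * m := by
        gcongr
        exact (hb _).2.trans (by gcongr; exact norm_mulVec_le_frobenius A y)
    _ = U * (n * ‖A‖) * (m * ‖y‖) := by ring
    _ ≤ U * (n * ‖A‖) * ν y := by
        gcongr
        exact (hb y).1

theorem prod_mulVec_le (h : IsNormOn ν) {N : ℝ} (hN : 0 ≤ N)
    (l : List (Matrix (Fin n) (Fin n) ℝ)) (hl : ∀ A ∈ l, opNormOf ν A ≤ N) (x : Fin n → ℝ) :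
    ν (l.prod.mulVec x) ≤ N ^ l.length * ν x := by
  induction l with
  | nil => simp
  | cons A l ih =>
    rw [List.prod_cons, ← Matrix.mulVec_mulVec, List.length_cons, pow_succ']
    calc ν (A.mulVec (l.prod.mulVec x)) ≤ opNormOf ν A * ν (l.prod.mulVec x) := h.le_opNormOf _ _
      _ ≤ N * (N ^ l.length * ν x) := by
        gcongr
        · exact h.nonneg _
        · exact hl A (by simp)
        · exact ih fun B hB => hl B (by simp [hB])
      _ = _ := by ring

theorem exists_frobenius_le (h : IsNormOn ν) : ∃ C > 0, ∀ (N : ℝ), 0 ≤ N →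
    ∀ l : List (Matrix (Fin n) (Fin n) ℝ), (∀ A ∈ l, opNormOf ν A ≤ N) →
      ‖l.prod‖ ≤ C * N ^ l.length := by
  obtain ⟨m, hm, U, hU, hb⟩ := h.exists_bounds
  refine ⟨n * (U / m) + 1, by positivity, fun N hN l hl => ?_⟩
  have key : ‖l.prod‖ ≤ n * (U / m * N ^ l.length) := by
    refine frobenius_le_of_entry_le _ (by positivity) fun i j => ?_
    have h1 : |l.prod i j| ≤ ‖l.prod.mulVec (Pi.single j 1)‖ := by
      have := norm_le_pi_norm (l.prod.mulVec (Pi.single j 1)) i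
      simpa using this
    have h2 := (hb (l.prod.mulVec (Pi.single j 1))).1
    have h3 := h.prod_mulVec_le hN l hl (Pi.single j 1)
    have h4 : ν (Pi.single j 1) ≤ U := by
      simpa [Pi.norm_single] using (hb (Pi.single j 1)).2
    have h5 : N ^ l.length * ν (Pi.single j 1) ≤ N ^ l.length * U := by gcongr
    rw [div_mul_eq_mul_div, le_div_iff₀ hm]
    nlinarith
  have : 0 ≤ N ^ l.length := by positivity
  nlinarith

end IsNormOn

theorem frobenius_list_prod_le {n : ℕ} {B : ℝ} (hB : 0 ≤ B)
    (l : List (Matrix (Fin n) (Fin n) ℝ)) (hl : ∀ A ∈ l, ‖A‖ ≤ B) :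
    ‖l.prod‖ ≤ ‖(1 : Matrix (Fin n) (Fin n) ℝ)‖ * B ^ l.length := by
  induction l with
  | nil => simp
  | cons A l ih =>
    rw [List.prod_cons, List.length_cons, pow_succ]
    calc ‖A * l.prod‖ ≤ ‖A‖ * ‖l.prod‖ := Matrix.frobenius_norm_mul _ _
      _ ≤ B * (‖(1 : Matrix (Fin n) (Fin n) ℝ)‖ * B ^ l.length) := by
        gcongr
        · exact hl A (by simp)
        · exact ih fun B hB => hl B (by simp [hB])
      _ = _ := by ring

section JointSpectralRadius

variable {n : ℕ} {M : Set (Matrix (Fin n) (Fin n) ℝ)}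

theorem sSup_rpow_prodsLen_nonneg (k : ℕ) :
    0 ≤ sSup ((fun P : Matrix (Fin n) (Fin n) ℝ => ‖P‖ ^ ((1:ℝ)/k)) '' prodsLen M k) := by
  refine Real.sSup_nonneg ?_
  rintro t ⟨P, -, rfl⟩
  positivity

/-- A uniform exponential bound on the norms of products controls their `k`-th roots. -/
theorem rpow_norm_le {C N : ℝ} (hC : 0 ≤ C) (hN : 0 ≤ N)
    (h : ∀ l : List (Matrix (Fin n) (Fin n) ℝ), (∀ A ∈ l, A ∈ M) → ‖l.prod‖ ≤ C * N ^ l.length)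
    {k : ℕ} (hk : k ≠ 0) {P : Matrix (Fin n) (Fin n) ℝ} (hP : P ∈ prodsLen M k) :
    ‖P‖ ^ ((1:ℝ)/k) ≤ C ^ ((1:ℝ)/k) * N := by
  obtain ⟨l, rfl, hl, rfl⟩ := hP
  calc ‖l.prod‖ ^ ((1:ℝ)/l.length) ≤ (C * N ^ l.length) ^ ((1:ℝ)/l.length) := by
        gcongr
        exact h l hl
    _ = C ^ ((1:ℝ)/l.length) * N := by
        rw [Real.mul_rpow hC (by positivity), one_div, Real.pow_rpow_inv_natCast hN hk]

theorem tendsto_const_rpow_mul {C N : ℝ} (hC : 0 < C) :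
    Tendsto (fun k : ℕ => C ^ ((1:ℝ)/k) * N) atTop (nhds N) := by
  have h1 : Tendsto (fun k : ℕ => C ^ ((1:ℝ)/k)) atTop (nhds (C ^ (0:ℝ))) :=
    tendsto_const_nhds.rpow tendsto_one_div_atTop_nhds_zero_nat (Or.inl hC.ne')
  simpa using h1.mul_const N

theorem eventually_sSup_rpow_le {C N : ℝ} (hC : 0 ≤ C) (hN : 0 ≤ N)
    (h : ∀ l : List (Matrix (Fin n) (Fin n) ℝ), (∀ A ∈ l, A ∈ M) →
      ‖l.prod‖ ≤ C * N ^ l.length) :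
    (fun k : ℕ => sSup ((fun P => ‖P‖ ^ ((1:ℝ)/k)) '' prodsLen M k)) ≤ᶠ[atTop]
      fun k : ℕ => C ^ ((1:ℝ)/k) * N := by
  filter_upwards [eventually_ne_atTop 0] with k hk
  refine Real.sSup_le ?_ (by positivity)
  rintro t ⟨P, hP, rfl⟩
  exact rpow_norm_le hC hN h hk hP

theorem jsr_le_of_norm_prod_le {C N : ℝ} (hC : 0 < C) (hN : 0 ≤ N)
    (h : ∀ l : List (Matrix (Fin n) (Fin n) ℝ), (∀ A ∈ l, A ∈ M) →
      ‖l.prod‖ ≤ C * N ^ l.length) : jsr M ≤ N := by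
  have ht := tendsto_const_rpow_mul (N := N) hC
  rw [← ht.limsup_eq]
  exact limsup_le_limsup (eventually_sSup_rpow_le hC.le hN h)
    (isCoboundedUnder_le_of_le atTop (x := 0) sSup_rpow_prodsLen_nonneg) ht.isBoundedUnder_le

theorem exists_norm_prod_le (hM : M.Finite) (r : ℝ) : ∃ C > 0, ∃ B > 0, r ≤ B ∧
    ∀ l : List (Matrix (Fin n) (Fin n) ℝ), (∀ A ∈ l, A ∈ M) →
      ‖l.prod‖ ≤ C * B ^ l.length := by
  obtain ⟨B, hB⟩ := (hM.image fun A => ‖A‖).bddAbove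
  have hB0 : 0 < max (max B r) 1 := by positivity
  refine ⟨‖(1 : Matrix (Fin n) (Fin n) ℝ)‖ + 1, by positivity, max (max B r) 1, hB0,
    (le_max_right _ _).trans (le_max_left _ _), fun l hl => ?_⟩
  refine (frobenius_list_prod_le hB0.le l fun A hA =>
    (hB ⟨A, hl A hA, rfl⟩).trans ((le_max_left _ _).trans (le_max_left _ _))).trans ?_
  gcongr
  linarith

theorem isBoundedUnder_sSup_rpow (hM : M.Finite) :
    IsBoundedUnder (· ≤ ·) atTop
      fun k : ℕ => sSup ((fun P => ‖P‖ ^ ((1:ℝ)/k)) '' prodsLen M k) := by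
  obtain ⟨C, hC, B, hB, -, h⟩ := exists_norm_prod_le hM 0
  exact (tendsto_const_rpow_mul hC).isBoundedUnder_le.mono_le
    (eventually_sSup_rpow_le hC.le hB.le h)

theorem jsr_nonneg (hM : M.Finite) : 0 ≤ jsr M :=
  le_limsup_of_frequently_le (Frequently.of_forall sSup_rpow_prodsLen_nonneg)
    (isBoundedUnder_sSup_rpow hM)

theorem exists_norm_prod_le_of_jsr_lt (hM : M.Finite) {r : ℝ} (hr : jsr M < r) :
    ∃ C > 0, ∀ l : List (Matrix (Fin n) (Fin n) ℝ), (∀ A ∈ l, A ∈ M) →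
      ‖l.prod‖ ≤ C * r ^ l.length := by
  have hr0 : 0 < r := (jsr_nonneg hM).trans_lt hr
  obtain ⟨C, hC, B, hB, hrB, h⟩ := exists_norm_prod_le hM r
  obtain ⟨K, hK⟩ := eventually_atTop.1
    ((eventually_lt_of_limsup_lt hr (isBoundedUnder_sSup_rpow hM)).and (eventually_ne_atTop 0))
  refine ⟨max 1 (C * (B / r) ^ K), by positivity, fun l hl => ?_⟩
  rcases le_total K l.length with hle | hle
  · obtain ⟨h1, h2⟩ := hK _ hle
    have hbdd : BddAbove ((fun P : Matrix (Fin n) (Fin n) ℝ => ‖P‖ ^ ((1:ℝ)/l.length)) ''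
        prodsLen M l.length) := by
      refine ⟨C ^ ((1:ℝ)/l.length) * B, ?_⟩
      rintro t ⟨P, hP, rfl⟩
      exact rpow_norm_le hC.le hB.le h h2 hP
    have h3 : ‖l.prod‖ ^ ((1:ℝ)/l.length) ≤ r :=
      (le_csSup hbdd ⟨l.prod, ⟨l, rfl, hl, rfl⟩, rfl⟩).trans h1.le
    have h4 : ‖l.prod‖ ≤ r ^ l.length := by
      rw [← Real.rpow_inv_natCast_pow (norm_nonneg l.prod) h2, ← one_div]
      gcongr
    refine h4.trans ?_
    nlinarith [le_max_left 1 (C * (B / r) ^ K), pow_pos hr0 l.length]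
  · have h1 : 1 ≤ B / r := (one_le_div hr0).2 hrB
    calc ‖l.prod‖ ≤ C * B ^ l.length := h l hl
      _ = C * (B / r) ^ l.length * r ^ l.length := by
          rw [div_pow]
          field_simp
      _ ≤ C * (B / r) ^ K * r ^ l.length := by gcongr
      _ ≤ _ := by gcongr; exact le_max_right _ _

theorem exists_isNormOn_opNormOf_le (hM : M.Finite) {r : ℝ} (hr : jsr M < r) :
    ∃ ν : (Fin n → ℝ) → ℝ, IsNormOn ν ∧ ∀ A ∈ M, opNormOf ν A ≤ r := by
  have hr0 : 0 < r := (jsr_nonneg hM).trans_lt hr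
  obtain ⟨C, hC, h⟩ := exists_norm_prod_le_of_jsr_lt hM hr
  let ι := {l : List (Matrix (Fin n) (Fin n) ℝ) // ∀ A ∈ l, A ∈ M}
  let f : (Fin n → ℝ) → ι → ℝ := fun x l => ‖l.1.prod.mulVec x‖ / r ^ l.1.length
  have : Nonempty ι := ⟨⟨[], by simp⟩⟩
  have hbdd : ∀ x, BddAbove (Set.range (f x)) := by
    intro x
    refine ⟨n * C * ‖x‖, ?_⟩
    rintro t ⟨l, rfl⟩
    refine (div_le_iff₀ (by positivity)).2 ((norm_mulVec_le_frobenius _ _).trans ?_)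
    calc n * ‖l.1.prod‖ * ‖x‖ ≤ n * (C * r ^ l.1.length) * ‖x‖ := by
          gcongr
          exact h l.1 l.2
      _ = _ := by ring
  have hν : IsNormOn fun x => ⨆ l, f x l := by
    refine ⟨fun x => ⟨fun hx => ?_, ?_⟩, fun c x => ?_, fun x y => ?_⟩
    · have h1 := le_ciSup (hbdd x) ⟨[], by simp⟩
      replace hx : ⨆ l, f x l = 0 := hx
      rw [hx] at h1
      simpa [f] using h1
    · rintro rfl
      simp [f]
    · rw [Real.mul_iSup_of_nonneg (abs_nonneg c)]
      refine iSup_congr fun l => ?_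
      simp only [f, Matrix.mulVec_smul, norm_smul, Real.norm_eq_abs]
      ring
    · refine ciSup_le fun l => ?_
      refine le_trans ?_ (add_le_add (le_ciSup (hbdd x) l) (le_ciSup (hbdd y) l))
      simp only [f, Matrix.mulVec_add, ← add_div]
      gcongr
      exact norm_add_le _ _
  refine ⟨_, hν, fun A hA => Real.sSup_le ?_ hr0.le⟩
  rintro t ⟨x, hx, rfl⟩
  refine (div_le_iff₀ (hν.pos hx)).2 (ciSup_le fun l => ?_)
  have h1 := le_ciSup (hbdd x) ⟨l.1 ++ [A], by
    intro B hB
    rcases List.mem_append.1 hB with hB | hB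
    · exact l.2 B hB
    · rw [List.mem_singleton.1 hB]
      exact hA⟩
  refine le_trans (le_of_eq ?_) (mul_le_mul_of_nonneg_left h1 hr0.le)
  simp only [f, List.prod_append, List.prod_singleton, List.length_append, List.length_singleton,
    Matrix.mulVec_mulVec, pow_succ]
  field_simp

end JointSpectralRadius

/-- the joint spectral radius is the infimum over all vector norms
`ν` on `ℝ^n` of the maximum over `A ∈ M` of the operator norm of `A` induced
by `ν`. -/
theorem stmt9 {n : ℕ} (M : Set (Matrix (Fin n) (Fin n) ℝ))
    (hMfin : M.Finite) (hMne : M.Nonempty) :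
    jsr M = sInf {r : ℝ | ∃ ν : (Fin n → ℝ) → ℝ, IsNormOn ν ∧
      r = sSup {c : ℝ | ∃ A ∈ M, c = opNormOf ν A}} := by
  have hle : ∀ ν : (Fin n → ℝ) → ℝ, IsNormOn ν →
      jsr M ≤ sSup {c : ℝ | ∃ A ∈ M, c = opNormOf ν A} := by
    intro ν hν
    have hbdd : BddAbove {c : ℝ | ∃ A ∈ M, c = opNormOf ν A} :=
      ((hMfin.image (opNormOf ν)).subset (by rintro c ⟨A, hA, rfl⟩; exact ⟨A, hA, rfl⟩)).bddAbove
    have hN : 0 ≤ sSup {c : ℝ | ∃ A ∈ M, c = opNormOf ν A} := by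
      refine Real.sSup_nonneg ?_
      rintro c ⟨A, -, rfl⟩
      exact hν.opNormOf_nonneg A
    obtain ⟨C, hC, h⟩ := hν.exists_frobenius_le
    exact jsr_le_of_norm_prod_le hC hN fun l hl =>
      h _ hN l fun A hA => le_csSup hbdd ⟨A, hl A hA, rfl⟩
  have hsSup : ∀ {ν : (Fin n → ℝ) → ℝ} {r : ℝ}, (∀ A ∈ M, opNormOf ν A ≤ r) →
      sSup {c : ℝ | ∃ A ∈ M, c = opNormOf ν A} ≤ r := by
    intro ν r h
    obtain ⟨A, hA⟩ := hMne
    refine csSup_le ⟨_, A, hA, rfl⟩ ?_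
    rintro c ⟨B, hB, rfl⟩
    exact h B hB
  apply le_antisymm
  · obtain ⟨ν, hν, -⟩ := exists_isNormOn_opNormOf_le hMfin (lt_add_one (jsr M))
    refine le_csInf ⟨_, ν, hν, rfl⟩ ?_
    rintro r ⟨μ, hμ, rfl⟩
    exact hle μ hμ
  · refine le_of_forall_gt_imp_ge_of_dense fun r hr => ?_
    obtain ⟨ν, hν, h⟩ := exists_isNormOn_opNormOf_le hMfin hr
    refine le_trans (csInf_le ⟨jsr M, ?_⟩ ⟨ν, hν, rfl⟩) (hsSup h)
    rintro r ⟨μ, hμ, rfl⟩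
    exact hle μ hμ
end

section
/- Let M be a finite nonempty set of real n×n matrices with joint spectral radius ρ̂(M) = 1 such that the multiplicative semigroup P(M) of all finite products of matrices of M is bounded. Then M admits an extremal norm: there exists a norm ν on ℝ^n such that max_{A∈M} of the operator norm of A induced by ν equals 1 = ρ̂(M). -/
open Matrix Filter

attribute [local instance] Matrix.frobeniusNormedAddCommGroup

section ExtremalNorm

variable {n : ℕ}

lemma frobenius_abs_entry_le (P : Matrix (Fin n) (Fin n) ℝ) (i j : Fin n) : |P i j| ≤ ‖P‖ := by
  rw [Matrix.frobenius_norm_def, ← Real.sqrt_eq_rpow]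
  refine Real.le_sqrt_of_sq_le ?_
  simp only [Real.rpow_two, Real.norm_eq_abs, sq_abs]
  calc P i j ^ 2 ≤ ∑ b, P i b ^ 2 :=
        Finset.single_le_sum (f := fun b => P i b ^ 2) (fun _ _ => sq_nonneg _) (Finset.mem_univ j)
    _ ≤ ∑ a, ∑ b, P a b ^ 2 :=
        Finset.single_le_sum (f := fun a => ∑ b, P a b ^ 2)
          (fun _ _ => Finset.sum_nonneg fun _ _ => sq_nonneg _) (Finset.mem_univ i)

lemma frobenius_norm_le_of_abs_entry_le (P Q : Matrix (Fin n) (Fin n) ℝ)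
    (h : ∀ i j, |P i j| ≤ |Q i j|) : ‖P‖ ≤ ‖Q‖ := by
  simp only [Matrix.frobenius_norm_def, Real.norm_eq_abs, Real.rpow_two]
  refine Real.rpow_le_rpow (by positivity) (Finset.sum_le_sum fun i _ =>
    Finset.sum_le_sum fun j _ => pow_le_pow_left₀ (abs_nonneg _) (h i j) 2) (by norm_num)

lemma norm_mulVec_le_card_mul_frobenius (P : Matrix (Fin n) (Fin n) ℝ) (x : Fin n → ℝ) :
    ‖P *ᵥ x‖ ≤ n * ‖P‖ * ‖x‖ := by
  refine (pi_norm_le_iff_of_nonneg (by positivity)).2 fun i => ?_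
  calc ‖(P *ᵥ x) i‖ ≤ ∑ j, ‖P i j * x j‖ :=
        norm_sum_le Finset.univ fun j => P i j * x j
    _ ≤ ∑ _j : Fin n, ‖P‖ * ‖x‖ := by
        refine Finset.sum_le_sum fun j _ => ?_
        rw [norm_mul]
        exact mul_le_mul (frobenius_abs_entry_le P i j) (norm_le_pi_norm x j)
          (norm_nonneg _) (norm_nonneg _)
    _ = n * ‖P‖ * ‖x‖ := by simp [mul_assoc]

/-- The largest sup norm of an image of `x` under the monoid generated by `M`. -/
noncomputable def orbitNorm (M : Set (Matrix (Fin n) (Fin n) ℝ)) (x : Fin n → ℝ) : ℝ :=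
  ⨆ l : {l : List (Matrix (Fin n) (Fin n) ℝ) // ∀ A ∈ l, A ∈ M}, ‖l.1.prod *ᵥ x‖

lemma bddAbove_orbit {M : Set (Matrix (Fin n) (Fin n) ℝ)}
    (hbdd : ∃ C : ℝ, ∀ k : ℕ, 1 ≤ k → ∀ P ∈ prodsLen M k, ‖P‖ ≤ C) (x : Fin n → ℝ) :
    BddAbove (Set.range fun l : {l : List (Matrix (Fin n) (Fin n) ℝ) // ∀ A ∈ l, A ∈ M} =>
      ‖l.1.prod *ᵥ x‖) := by
  obtain ⟨C, hC⟩ := hbdd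
  refine ⟨n * max C ‖(1 : Matrix (Fin n) (Fin n) ℝ)‖ * ‖x‖, ?_⟩
  rintro _ ⟨⟨l, hl⟩, rfl⟩
  refine (norm_mulVec_le_card_mul_frobenius _ _).trans ?_
  gcongr
  cases l with
  | nil => simp
  | cons A l => exact (hC _ (by simp) _ ⟨A :: l, rfl, hl, rfl⟩).trans (le_max_left _ _)

lemma norm_le_orbitNorm {M : Set (Matrix (Fin n) (Fin n) ℝ)}
    (hbdd : ∃ C : ℝ, ∀ k : ℕ, 1 ≤ k → ∀ P ∈ prodsLen M k, ‖P‖ ≤ C) (x : Fin n → ℝ) :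
    ‖x‖ ≤ orbitNorm M x := by
  simpa [orbitNorm] using le_ciSup (bddAbove_orbit hbdd x) ⟨[], by simp⟩

lemma orbitNorm_mulVec_le {M : Set (Matrix (Fin n) (Fin n) ℝ)}
    (hbdd : ∃ C : ℝ, ∀ k : ℕ, 1 ≤ k → ∀ P ∈ prodsLen M k, ‖P‖ ≤ C)
    {A : Matrix (Fin n) (Fin n) ℝ} (hA : A ∈ M) (x : Fin n → ℝ) :
    orbitNorm M (A *ᵥ x) ≤ orbitNorm M x := by
  have : Nonempty {l : List (Matrix (Fin n) (Fin n) ℝ) // ∀ A ∈ l, A ∈ M} := ⟨⟨[], by simp⟩⟩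
  refine ciSup_le fun ⟨l, hl⟩ => ?_
  have h := le_ciSup (bddAbove_orbit hbdd x) ⟨l ++ [A], by
    intro B hB
    rcases List.mem_append.1 hB with h | h
    · exact hl B h
    · rwa [List.mem_singleton.1 h]⟩
  simpa [orbitNorm, Matrix.mulVec_mulVec] using h

lemma isNormOn_orbitNorm {M : Set (Matrix (Fin n) (Fin n) ℝ)}
    (hbdd : ∃ C : ℝ, ∀ k : ℕ, 1 ≤ k → ∀ P ∈ prodsLen M k, ‖P‖ ≤ C) :
    IsNormOn (orbitNorm M) := by
  have : Nonempty {l : List (Matrix (Fin n) (Fin n) ℝ) // ∀ A ∈ l, A ∈ M} := ⟨⟨[], by simp⟩⟩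
  refine ⟨fun x => ⟨fun h => ?_, ?_⟩, fun c x => ?_, fun x y => ?_⟩
  · exact norm_le_zero_iff.1 ((norm_le_orbitNorm hbdd x).trans h.le)
  · rintro rfl
    simp [orbitNorm]
  · simp only [orbitNorm, Matrix.mulVec_smul, norm_smul, Real.norm_eq_abs]
    rw [Real.mul_iSup_of_nonneg (abs_nonneg c)]
  · refine ciSup_le fun l => ?_
    rw [Matrix.mulVec_add]
    exact (norm_add_le _ _).trans
      (add_le_add (le_ciSup (bddAbove_orbit hbdd x) l) (le_ciSup (bddAbove_orbit hbdd y) l))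

lemma IsNormOn.nonneg_s15 {ν : (Fin n → ℝ) → ℝ} (hν : IsNormOn ν) (x : Fin n → ℝ) : 0 ≤ ν x := by
  have h := hν.2.2 x ((-1 : ℝ) • x)
  rw [hν.2.1, neg_one_smul, add_neg_cancel, (hν.1 0).2 rfl] at h
  norm_num at h
  exact h

lemma IsNormOn.opNormOf_le {ν : (Fin n → ℝ) → ℝ} (hν : IsNormOn ν)
    {A : Matrix (Fin n) (Fin n) ℝ} {c : ℝ} (hc : 0 ≤ c) (h : ∀ x, ν (A *ᵥ x) ≤ c * ν x) :
    opNormOf ν A ≤ c := by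
  refine Real.sSup_le ?_ hc
  rintro _ ⟨x, -, rfl⟩
  exact div_le_of_le_mul₀ (hν.nonneg_s15 x) hc (h x)

lemma IsNormOn.opNormOf_nonneg_s15 {ν : (Fin n → ℝ) → ℝ} (hν : IsNormOn ν)
    (A : Matrix (Fin n) (Fin n) ℝ) : 0 ≤ opNormOf ν A := by
  refine Real.sSup_nonneg ?_
  rintro _ ⟨x, -, rfl⟩
  exact div_nonneg (hν.nonneg_s15 _) (hν.nonneg_s15 _)

lemma IsNormOn.le_opNormOf_mul {ν : (Fin n → ℝ) → ℝ} (hν : IsNormOn ν)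
    {A : Matrix (Fin n) (Fin n) ℝ} {c : ℝ} (h : ∀ x, ν (A *ᵥ x) ≤ c * ν x) (x : Fin n → ℝ) :
    ν (A *ᵥ x) ≤ opNormOf ν A * ν x := by
  rcases eq_or_ne x 0 with rfl | hx
  · simp [(hν.1 0).2 rfl]
  have hpos : 0 < ν x := (hν.nonneg_s15 x).lt_of_ne fun h0 => hx ((hν.1 x).1 h0.symm)
  rw [← div_le_iff₀ hpos]
  refine le_csSup ⟨c, ?_⟩ ⟨x, hx, rfl⟩
  rintro _ ⟨y, hy, rfl⟩
  have hpos' : 0 < ν y := (hν.nonneg_s15 y).lt_of_ne fun h0 => hy ((hν.1 y).1 h0.symm)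
  exact (div_le_iff₀ hpos').2 (h y)

lemma norm_prod_mulVec_le {M : Set (Matrix (Fin n) (Fin n) ℝ)} {ν : (Fin n → ℝ) → ℝ} {r : ℝ}
    (hr : 0 ≤ r) (h : ∀ A ∈ M, ∀ x, ν (A *ᵥ x) ≤ r * ν x)
    (l : List (Matrix (Fin n) (Fin n) ℝ)) (hl : ∀ A ∈ l, A ∈ M) (x : Fin n → ℝ) :
    ν (l.prod *ᵥ x) ≤ r ^ l.length * ν x := by
  induction l with
  | nil => simp
  | cons A l ih =>
    rw [List.prod_cons, ← Matrix.mulVec_mulVec, List.length_cons, pow_succ', mul_assoc]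
    exact (h A (hl A (by simp)) _).trans
      (mul_le_mul_of_nonneg_left (ih fun B hB => hl B (by simp [hB])) hr)

lemma exists_frobenius_norm_le_mul_pow {M : Set (Matrix (Fin n) (Fin n) ℝ)}
    {ν : (Fin n → ℝ) → ℝ} {r : ℝ} (hr : 0 ≤ r) (hnorm : ∀ x, ‖x‖ ≤ ν x)
    (h : ∀ A ∈ M, ∀ x, ν (A *ᵥ x) ≤ r * ν x) :
    ∃ K : ℝ, 0 < K ∧ ∀ k, ∀ P ∈ prodsLen M k, ‖P‖ ≤ K * r ^ k := by
  let Q : Matrix (Fin n) (Fin n) ℝ := Matrix.of fun _ j => ν (Pi.single j 1)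
  refine ⟨‖Q‖ + 1, by positivity, ?_⟩
  rintro k _ ⟨l, rfl, hl, rfl⟩
  calc ‖l.prod‖ ≤ ‖Matrix.of fun i j => r ^ l.length * Q i j‖ := by
        refine frobenius_norm_le_of_abs_entry_le _ _ fun i j => ?_
        calc |l.prod i j| = ‖(l.prod *ᵥ Pi.single j 1) i‖ := by simp
          _ ≤ ‖l.prod *ᵥ Pi.single j 1‖ := norm_le_pi_norm _ i
          _ ≤ r ^ l.length * ν (Pi.single j 1) :=
              (hnorm _).trans (norm_prod_mulVec_le hr h l hl _)
          _ ≤ _ := le_abs_self _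
    _ = ‖Q‖ * r ^ l.length := by
        let _ := Matrix.frobeniusNormedSpace (R := ℝ) (α := ℝ) (m := Fin n) (n := Fin n)
        have : (Matrix.of fun i j => r ^ l.length * Q i j) = r ^ l.length • Q := rfl
        rw [this, norm_smul, Real.norm_of_nonneg (by positivity), mul_comm]
    _ ≤ (‖Q‖ + 1) * r ^ l.length := by gcongr; linarith

lemma jsr_le_of_norm_le_mul_pow {M : Set (Matrix (Fin n) (Fin n) ℝ)} {K r : ℝ} (hK : 0 < K)
    (hr : 0 ≤ r) (h : ∀ k, ∀ P ∈ prodsLen M k, ‖P‖ ≤ K * r ^ k) : jsr M ≤ r := by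
  have hlim : Tendsto (fun k : ℕ => K ^ ((1 : ℝ) / k) * r) atTop (nhds r) := by
    have h1 : Tendsto (fun k : ℕ => K ^ ((1 : ℝ) / k)) atTop (nhds (K ^ (0 : ℝ))) :=
      tendsto_const_nhds.rpow tendsto_one_div_atTop_nhds_zero_nat (Or.inl hK.ne')
    simpa using h1.mul_const r
  rw [← hlim.limsup_eq]
  refine limsup_le_limsup ?_ ?_ hlim.isBoundedUnder_le
  · filter_upwards [eventually_ge_atTop 1] with k hk
    have hk' : (k : ℝ) ≠ 0 := by positivity
    refine Real.sSup_le ?_ (by positivity)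
    rintro _ ⟨P, hP, rfl⟩
    calc ‖P‖ ^ ((1 : ℝ) / k) ≤ (K * r ^ k) ^ ((1 : ℝ) / k) := by
          gcongr
          exact h k P hP
      _ = K ^ ((1 : ℝ) / k) * r := by
          rw [Real.mul_rpow hK.le (by positivity), ← Real.rpow_natCast r k, ← Real.rpow_mul hr,
            mul_one_div_cancel hk', Real.rpow_one]
  · refine isCoboundedUnder_le_of_le atTop (x := 0) fun k => Real.sSup_nonneg ?_
    rintro _ ⟨P, -, rfl⟩
    positivity

end ExtremalNorm


/-- if `ρ̂(M) = 1` and the multiplicative semigroup of all finite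
products of matrices of `M` is bounded, then `M` admits an extremal norm:
a norm `ν` with `max_{A ∈ M} ‖A‖_ν = 1 = ρ̂(M)`. -/
theorem stmt15 {n : ℕ} (M : Set (Matrix (Fin n) (Fin n) ℝ))
    (hMfin : M.Finite) (hMne : M.Nonempty)
    (hjsr : jsr M = 1)
    (hbdd : ∃ C : ℝ, ∀ k : ℕ, 1 ≤ k → ∀ P ∈ prodsLen M k, ‖P‖ ≤ C) :
    ∃ ν : (Fin n → ℝ) → ℝ, IsNormOn ν ∧
      sSup {c : ℝ | ∃ A ∈ M, c = opNormOf ν A} = 1 := by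
  have hν := isNormOn_orbitNorm hbdd
  have hone : ∀ A ∈ M, ∀ x, orbitNorm M (A *ᵥ x) ≤ 1 * orbitNorm M x := fun A hA x => by
    simpa using orbitNorm_mulVec_le hbdd hA x
  have hle : ∀ c ∈ {c : ℝ | ∃ A ∈ M, c = opNormOf (orbitNorm M) A}, c ≤ 1 := by
    rintro _ ⟨A, hA, rfl⟩
    exact hν.opNormOf_le zero_le_one (hone A hA)
  refine ⟨orbitNorm M, hν, le_antisymm (Real.sSup_le hle zero_le_one) ?_⟩
  set s := sSup {c : ℝ | ∃ A ∈ M, c = opNormOf (orbitNorm M) A}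
  have hs0 : 0 ≤ s := Real.sSup_nonneg (by rintro _ ⟨A, -, rfl⟩; exact hν.opNormOf_nonneg_s15 A)
  have hcontr : ∀ A ∈ M, ∀ x, orbitNorm M (A *ᵥ x) ≤ s * orbitNorm M x := fun A hA x =>
    (hν.le_opNormOf_mul (hone A hA) x).trans
      (mul_le_mul_of_nonneg_right (le_csSup ⟨1, hle⟩ ⟨A, hA, rfl⟩) (hν.nonneg_s15 x))
  obtain ⟨K, hK, hpow⟩ := exists_frobenius_norm_le_mul_pow hs0 (norm_le_orbitNorm hbdd) hcontr
  exact hjsr ▸ jsr_le_of_norm_le_mul_pow hK hs0 hpow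
end
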